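/- arXiv:2102.12012 — 4 statements merged into one kernel-verified Lean document; each statement's English description precedes it below -/
import Mathlib

section
/- For every constant ε > 0, every constant c > 0, and every unbounded increasing function ω : ℕ → ℝ, the following holds. For each n, let G = G(n) be a d-regular graph on n vertices with d ≥ c·n, and let p = (2 + ε/2)·(log n)/d. Form the random subgraph G_p by keeping each edge of G independently with probability p, and color each edge of G_p independently and uniformly at random from {1, …, n−1}. Then a.a.s. the following holds simultaneously for every color set K ⊆ {1, …, n−1} with |K| ≤ n/(ω(n)·log n): at least |K|·(log n)/ω(n) vertices of G_p are incident in G_p to at least one edge whose color belongs to K. -/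
open Finset SimpleGraph Filter
open scoped Classical

/-- The probability that the random subgraph of `G` obtained by keeping each edge
independently with probability `p`, with every (potential) edge colored independently and
uniformly at random from the `n - 1` colors `Fin (n - 1)`, satisfies the property `P`
(as a function of the set of kept edges and of the coloring). -/
noncomputable def prColored (n : ℕ) (G : SimpleGraph (Fin n)) (p : ℝ)
    (P : Finset (Sym2 (Fin n)) → (Sym2 (Fin n) → Fin (n - 1)) → Prop) : ℝ :=
  ∑ H ∈ G.edgeFinset.powerset, ∑ φ : Sym2 (Fin n) → Fin (n - 1),
    p ^ H.card * (1 - p) ^ (G.edgeFinset.card - H.card) *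
      (1 / (n - 1 : ℝ)) ^ Fintype.card (Sym2 (Fin n)) *
      (if P H φ then 1 else 0)

/-- The expectation of `F` over the randomly colored random subgraph `G_p`. -/
noncomputable def expColored (n : ℕ) (G : SimpleGraph (Fin n)) (p : ℝ)
    (F : Finset (Sym2 (Fin n)) → (Sym2 (Fin n) → Fin (n - 1)) → ℝ) : ℝ :=
  ∑ H ∈ G.edgeFinset.powerset, ∑ φ : Sym2 (Fin n) → Fin (n - 1),
    p ^ H.card * (1 - p) ^ (G.edgeFinset.card - H.card) *
      (1 / (n - 1 : ℝ)) ^ Fintype.card (Sym2 (Fin n)) * F H φ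

lemma expColored_mono {n : ℕ} (hn : 2 ≤ n) {G : SimpleGraph (Fin n)} {p : ℝ}
    (hp0 : 0 ≤ p) (hp1 : p ≤ 1)
    {F F' : Finset (Sym2 (Fin n)) → (Sym2 (Fin n) → Fin (n - 1)) → ℝ}
    (h : ∀ H φ, H ⊆ G.edgeFinset → F H φ ≤ F' H φ) :
    expColored n G p F ≤ expColored n G p F' := by
  have hn' : (2 : ℝ) ≤ n := by exact_mod_cast hn
  refine Finset.sum_le_sum fun H hH => Finset.sum_le_sum fun φ _ =>
    mul_le_mul_of_nonneg_left (h H φ (Finset.mem_powerset.1 hH)) ?_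
  have h1 : 0 ≤ 1 - p := by linarith
  have h2 : (0 : ℝ) ≤ 1 / (n - 1 : ℝ) := div_nonneg zero_le_one (by linarith)
  positivity

lemma expColored_sum {ι : Type*} {n : ℕ} {G : SimpleGraph (Fin n)} {p : ℝ} (s : Finset ι)
    (F : ι → Finset (Sym2 (Fin n)) → (Sym2 (Fin n) → Fin (n - 1)) → ℝ) :
    expColored n G p (fun H φ => ∑ i ∈ s, F i H φ) = ∑ i ∈ s, expColored n G p (F i) := by
  unfold expColored
  symm
  rw [Finset.sum_comm]
  refine Finset.sum_congr rfl fun H _ => ?_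
  rw [Finset.sum_comm]
  refine Finset.sum_congr rfl fun φ _ => ?_
  rw [Finset.mul_sum]

lemma expColored_const_mul {n : ℕ} {G : SimpleGraph (Fin n)} {p : ℝ} (a : ℝ)
    (F : Finset (Sym2 (Fin n)) → (Sym2 (Fin n) → Fin (n - 1)) → ℝ) :
    expColored n G p (fun H φ => a * F H φ) = a * expColored n G p F := by
  unfold expColored
  rw [Finset.mul_sum]
  refine Finset.sum_congr rfl fun H _ => ?_
  rw [Finset.mul_sum]
  refine Finset.sum_congr rfl fun φ _ => ?_
  ring

lemma sum_coloring_avoid {n : ℕ} (hn : 2 ≤ n) (U : Finset (Sym2 (Fin n)))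
    (K : Finset (Fin (n - 1))) :
    ∑ φ : Sym2 (Fin n) → Fin (n - 1), (1 / (n - 1 : ℝ)) ^ Fintype.card (Sym2 (Fin n)) *
      (if ∀ e ∈ U, φ e ∉ K then 1 else 0) = (1 - K.card / (n - 1 : ℝ)) ^ U.card := by
  have hM : (n : ℝ) - 1 ≠ 0 := by
    have : (2 : ℝ) ≤ n := by exact_mod_cast hn
    linarith
  have hcast : ((n - 1 : ℕ) : ℝ) = n - 1 := by
    rw [Nat.cast_sub (by lia)]; simp
  have hprod : ∀ φ : Sym2 (Fin n) → Fin (n - 1),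
      (1 / (n - 1 : ℝ)) ^ Fintype.card (Sym2 (Fin n)) * (if ∀ e ∈ U, φ e ∉ K then 1 else 0) =
        ∏ e, (1 / (n - 1 : ℝ)) * (if e ∈ U → φ e ∉ K then 1 else 0) := by
    intro φ
    rw [Finset.prod_mul_distrib, Finset.prod_const, Finset.card_univ]
    congr 1
    rw [Finset.prod_boole]
    simp
  have hfactor : ∀ e : Sym2 (Fin n),
      ∑ x : Fin (n - 1), (1 / (n - 1 : ℝ)) * (if e ∈ U → x ∉ K then 1 else 0) =
        if e ∈ U then 1 - K.card / (n - 1 : ℝ) else 1 := by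
    intro e
    rw [← Finset.mul_sum]
    by_cases he : e ∈ U
    · have : ∑ x : Fin (n - 1), (if x ∉ K then (1 : ℝ) else 0) = (n - 1) - K.card := by
        rw [Finset.sum_boole, ← hcast]
        have h := Finset.card_compl_add_card K
        rw [Fintype.card_fin] at h
        have h' : (Finset.univ.filter fun x => x ∉ K) = Kᶜ := by ext; simp
        rw [h', eq_sub_iff_add_eq]
        exact_mod_cast h
      simp only [he, true_implies, if_true, this]
      field_simp
    · simp [he, hcast, hM]
  rw [Finset.sum_congr rfl fun φ _ => hprod φ,
    ← Fintype.prod_sum (fun (e : Sym2 (Fin n)) (x : Fin (n - 1)) =>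
      (1 / (n - 1 : ℝ)) * (if e ∈ U → x ∉ K then 1 else 0)),
    Finset.prod_congr rfl fun e _ => hfactor e, Finset.prod_ite]
  simp

/-- The probability that no edge of `W` is kept with a color in `K`. -/
lemma expColored_avoid {n : ℕ} (hn : 2 ≤ n) (G : SimpleGraph (Fin n)) (p : ℝ)
    {W : Finset (Sym2 (Fin n))} (hW : W ⊆ G.edgeFinset) (K : Finset (Fin (n - 1))) :
    expColored n G p (fun H φ => if ∀ e ∈ W, e ∈ H → φ e ∉ K then 1 else 0) =
      (1 - p * (K.card / (n - 1 : ℝ))) ^ W.card := by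
  set r : ℝ := K.card / (n - 1 : ℝ)
  have hterm : ∀ H ∈ G.edgeFinset.powerset, ∑ φ : Sym2 (Fin n) → Fin (n - 1),
      p ^ H.card * (1 - p) ^ (G.edgeFinset.card - H.card) *
        (1 / (n - 1 : ℝ)) ^ Fintype.card (Sym2 (Fin n)) *
          (if ∀ e ∈ W, e ∈ H → φ e ∉ K then 1 else 0) =
      (∏ e ∈ H, p * (if e ∈ W then 1 - r else 1)) *
        ∏ e ∈ G.edgeFinset \ H, (1 - p) := by
    intro H hH
    have h := sum_coloring_avoid hn (H.filter (· ∈ W)) K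
    have hiff : ∀ φ : Sym2 (Fin n) → Fin (n - 1),
        (∀ e ∈ W, e ∈ H → φ e ∉ K) ↔ ∀ e ∈ H.filter (· ∈ W), φ e ∉ K := by
      intro φ
      simp only [Finset.mem_filter]
      tauto
    rw [← Finset.mul_sum] at h
    simp only [mul_assoc, ← Finset.mul_sum, hiff]
    rw [h, Finset.prod_mul_distrib, Finset.prod_const, Finset.prod_const,
      Finset.card_sdiff_of_subset (Finset.mem_powerset.1 hH), Finset.prod_ite]
    simp only [Finset.prod_const, one_pow, mul_one]
    ring
  unfold expColored
  rw [Finset.sum_congr rfl hterm, ← Finset.prod_add]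
  have hfactor : ∀ e ∈ G.edgeFinset, p * (if e ∈ W then 1 - r else 1) + (1 - p) =
      if e ∈ W then 1 - p * r else 1 := by
    intro e _
    split_ifs <;> ring
  rw [Finset.prod_congr rfl hfactor, Finset.prod_ite, Finset.prod_const, Finset.prod_const_one,
    mul_one, Finset.filter_mem_eq_inter, Finset.inter_eq_right.2 hW]

lemma expColored_one {n : ℕ} (hn : 2 ≤ n) (G : SimpleGraph (Fin n)) (p : ℝ) :
    expColored n G p (fun _ _ => 1) = 1 := by
  simpa using expColored_avoid hn G p (Finset.empty_subset _) ∅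

/-- The vertices incident to a kept edge with a color in `K`. -/
noncomputable def hitVertices {n : ℕ} (H : Finset (Sym2 (Fin n)))
    (φ : Sym2 (Fin n) → Fin (n - 1)) (K : Finset (Fin (n - 1))) : Finset (Fin n) :=
  Finset.univ.filter fun v : Fin n => ∃ e ∈ H, v ∈ e ∧ φ e ∈ K

/-- The edges of `G` whose chosen endpoint is `v`. -/
noncomputable def ownedEdges {n : ℕ} (G : SimpleGraph (Fin n)) (v : Fin n) :
    Finset (Sym2 (Fin n)) :=
  G.edgeFinset.filter fun e => e.out.1 = v

lemma card_ownedEdges_le {n : ℕ} (G : SimpleGraph (Fin n)) (v : Fin n) :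
    (ownedEdges G v).card ≤ G.degree v := by
  rw [← G.card_incidenceFinset_eq_degree]
  refine Finset.card_le_card fun e he => ?_
  simp only [ownedEdges, Finset.mem_filter, mem_edgeFinset] at he
  rw [mem_incidenceFinset]
  exact ⟨he.1, he.2 ▸ Sym2.out_fst_mem e⟩

lemma sum_card_ownedEdges {n : ℕ} (G : SimpleGraph (Fin n)) :
    ∑ v, (ownedEdges G v).card = G.edgeFinset.card :=
  (Finset.card_eq_sum_card_fiberwise (t := Finset.univ) fun _ _ => Finset.mem_univ _).symm

lemma pow_card_hitVertices_le {n : ℕ} {G : SimpleGraph (Fin n)} {H : Finset (Sym2 (Fin n))}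
    (φ : Sym2 (Fin n) → Fin (n - 1)) (K : Finset (Fin (n - 1))) {y : ℝ}
    (hy0 : 0 ≤ y) (hy1 : y ≤ 1) :
    y ^ (hitVertices H φ K).card ≤ ∏ v : Fin n,
      ((1 - y) * (if ∀ e ∈ ownedEdges G v, e ∈ H → φ e ∉ K then 1 else 0) + y) := by
  have h : y ^ (hitVertices H φ K).card =
      ∏ v : Fin n, if v ∈ hitVertices H φ K then y else 1 := by
    rw [Finset.prod_ite, Finset.prod_const, Finset.prod_const_one, mul_one,
      Finset.filter_mem_eq_inter, Finset.univ_inter]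
  rw [h]
  refine Finset.prod_le_prod (fun v _ => by split_ifs <;> simp [hy0]) fun v _ => ?_
  by_cases hv : ∀ e ∈ ownedEdges G v, e ∈ H → φ e ∉ K
  · rw [if_pos hv]
    split_ifs <;> linarith
  · have hmem : v ∈ hitVertices H φ K := by
      push Not at hv
      obtain ⟨e, he, heH, heK⟩ := hv
      refine Finset.mem_filter.2 ⟨Finset.mem_univ v, e, heH, ?_, heK⟩
      exact (Finset.mem_filter.1 he).2 ▸ Sym2.out_fst_mem e
    rw [if_neg hv, if_pos hmem, mul_zero, zero_add]

lemma expColored_pow_card_hitVertices_le {n : ℕ} (hn : 2 ≤ n) (G : SimpleGraph (Fin n))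
    {p : ℝ} (hp0 : 0 ≤ p) (hp1 : p ≤ 1) (K : Finset (Fin (n - 1))) {y : ℝ}
    (hy0 : 0 ≤ y) (hy1 : y ≤ 1) :
    expColored n G p (fun H φ => y ^ (hitVertices H φ K).card) ≤
      ∏ v : Fin n, ((1 - y) * (1 - p * (K.card / (n - 1 : ℝ))) ^ (ownedEdges G v).card + y) := by
  refine (expColored_mono hn hp0 hp1 fun H φ _ =>
    pow_card_hitVertices_le (G := G) φ K hy0 hy1).trans_eq ?_
  simp only [Finset.prod_add, Finset.prod_mul_distrib, Finset.prod_const]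
  rw [expColored_sum]
  refine Finset.sum_congr rfl fun A _ => ?_
  have hcard : (A.biUnion (ownedEdges G)).card = ∑ v ∈ A, (ownedEdges G v).card := by
    refine Finset.card_biUnion fun v _ w _ hvw => ?_
    refine Finset.disjoint_left.2 ?_
    intro e he he'
    simp only [ownedEdges, Finset.mem_filter] at he he'
    exact hvw (he.2.symm.trans he'.2)
  have hsub : A.biUnion (ownedEdges G) ⊆ G.edgeFinset :=
    Finset.biUnion_subset.2 fun v _ => Finset.filter_subset _ _
  have h := expColored_avoid hn G p hsub K
  rw [hcard, ← Finset.prod_pow_eq_pow_sum] at h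
  rw [← h, mul_right_comm, ← expColored_const_mul]
  congr 1
  funext H φ
  rw [mul_right_comm, Finset.prod_boole]
  congr 2
  simp only [Finset.mem_biUnion, eq_iff_iff]
  constructor
  · rintro h e ⟨v, hv, he⟩
    exact h v hv e he
  · exact fun h v hv e he => h e ⟨v, hv, he⟩

lemma owned_factor_le {y q η : ℝ} (m : ℕ) (hy1 : y ≤ 1) (hq0 : 0 ≤ q)
    (hq1 : q ≤ 1) (hη : q * m ≤ η) :
    (1 - y) * (1 - q) ^ m + y ≤ Real.exp (-((1 - y) * q / (1 + η) * m)) := by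
  have hx : 0 ≤ q * m := by positivity
  have h1 : (1 - q) ^ m ≤ Real.exp (-(q * m)) := by
    have h := pow_le_pow_left₀ (by linarith) (Real.one_sub_le_exp_neg q) m
    rwa [← Real.exp_nat_mul, mul_neg, mul_comm (m : ℝ)] at h
  have h2 : Real.exp (-(q * m)) ≤ 1 - q * m / (1 + η) := by
    have h3 : Real.exp (-(q * m)) ≤ 1 / (1 + q * m) := by
      rw [Real.exp_neg, ← one_div]
      exact one_div_le_one_div_of_le (by linarith) (by linarith [Real.add_one_le_exp (q * m)])
    have h4 : 1 / (1 + q * m) = 1 - q * m / (1 + q * m) := by field_simp; ring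
    have h5 : q * m / (1 + η) ≤ q * m / (1 + q * m) :=
      div_le_div_of_nonneg_left hx (by linarith) (by linarith)
    linarith
  have h6 := mul_le_mul_of_nonneg_left (h1.trans h2) (sub_nonneg.2 hy1)
  have h7 := Real.one_sub_le_exp_neg ((1 - y) * q / (1 + η) * m)
  have h8 : (1 - y) * (1 - q * m / (1 + η)) + y = 1 - (1 - y) * q / (1 + η) * m := by ring
  linarith

lemma expColored_pow_card_hitVertices_le_exp {n : ℕ} (hn : 2 ≤ n) {G : SimpleGraph (Fin n)}
    {d : ℕ} (hG : G.IsRegularOfDegree d) {p : ℝ} (hp0 : 0 ≤ p) (hp1 : p ≤ 1)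
    (K : Finset (Fin (n - 1))) {y η : ℝ} (hy0 : 0 ≤ y) (hy1 : y ≤ 1)
    (hη : p * (K.card / (n - 1 : ℝ)) * d ≤ η) :
    expColored n G p (fun H φ => y ^ (hitVertices H φ K).card) ≤
      Real.exp (-((1 - y) * (p * (K.card / (n - 1 : ℝ))) / (1 + η) * (n * d / 2))) := by
  have hn' : (2 : ℝ) ≤ n := by exact_mod_cast hn
  set q : ℝ := p * (K.card / (n - 1 : ℝ)) with hq
  have hr0 : 0 ≤ (K.card / (n - 1 : ℝ)) := div_nonneg (Nat.cast_nonneg _) (by linarith)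
  have hr1 : (K.card / (n - 1 : ℝ)) ≤ 1 := by
    rw [div_le_one (by linarith)]
    have h := Finset.card_le_univ K
    rw [Fintype.card_fin] at h
    have h' : (K.card : ℝ) + 1 ≤ n := by exact_mod_cast (by lia : K.card + 1 ≤ n)
    linarith
  have hq0 : 0 ≤ q := mul_nonneg hp0 hr0
  have hq1 : q ≤ 1 := mul_le_one₀ hp1 hr0 hr1
  have hedges : (G.edgeFinset.card : ℝ) = n * d / 2 := by
    have h := G.sum_degrees_eq_twice_card_edges
    simp only [hG.degree_eq, Finset.sum_const, Finset.card_univ, Fintype.card_fin,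
      smul_eq_mul] at h
    have h' : (n : ℝ) * d = 2 * (G.edgeFinset.card : ℝ) := by exact_mod_cast h
    linarith
  refine (expColored_pow_card_hitVertices_le hn G hp0 hp1 K hy0 hy1).trans ?_
  have hfactor : ∀ v ∈ (Finset.univ : Finset (Fin n)),
      (1 - y) * (1 - q) ^ (ownedEdges G v).card + y ≤
        Real.exp (-((1 - y) * q / (1 + η) * (ownedEdges G v).card)) := by
    intro v _
    refine owned_factor_le _ hy1 hq0 hq1 (le_trans ?_ hη)
    have h := card_ownedEdges_le G v
    rw [hG.degree_eq] at h
    exact mul_le_mul_of_nonneg_left (by exact_mod_cast h) hq0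
  refine (Finset.prod_le_prod (fun v _ => ?_) hfactor).trans_eq ?_
  · exact add_nonneg (mul_nonneg (by linarith) (pow_nonneg (by linarith) _)) hy0
  · rw [← Real.exp_sum, Finset.sum_neg_distrib, ← Finset.mul_sum, ← Nat.cast_sum,
      sum_card_ownedEdges, hedges]

lemma sum_pow_card_nonempty_le (m : ℕ) {z : ℝ} (hz : 0 ≤ z) :
    ∑ K : Finset (Fin m) with K.Nonempty, z ^ K.card ≤ Real.exp (m * z) - 1 := by
  have h1 : ∑ K : Finset (Fin m), z ^ K.card = (z + 1) ^ m := by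
    simpa using Fin.sum_pow_mul_eq_add_pow z 1 (n := m)
  have h2 := Finset.sum_filter_add_sum_filter_not Finset.univ
    (fun K : Finset (Fin m) => K.Nonempty) fun K => z ^ K.card
  have h3 : ∑ K : Finset (Fin m) with ¬ K.Nonempty, z ^ K.card = 1 := by
    have : (Finset.univ.filter fun K : Finset (Fin m) => ¬ K.Nonempty) = {∅} := by
      ext K; simp [Finset.not_nonempty_iff_eq_empty]
    rw [this]; simp
  have h4 : (z + 1) ^ m ≤ Real.exp (m * z) := by
    rw [Real.exp_nat_mul]
    exact pow_le_pow_left₀ (by linarith) (Real.add_one_le_exp z) m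
  linarith

/-- A union bound over the color sets `K` with at most `b` elements. -/
lemma one_sub_le_prColored {n : ℕ} (hn : 2 ≤ n) {G : SimpleGraph (Fin n)} {p : ℝ}
    (hp0 : 0 ≤ p) (hp1 : p ≤ 1) {b a y z : ℝ} (hz : 0 ≤ z) (hy0 : 0 < y) (hy1 : y ≤ 1)
    (h : ∀ K : Finset (Fin (n - 1)), (K.card : ℝ) ≤ b →
      y ^ (-(K.card * a)) * expColored n G p (fun H φ => y ^ (hitVertices H φ K).card) ≤
        z ^ K.card) :
    2 - Real.exp ((n - 1 : ℕ) * z) ≤ prColored n G p (fun H φ => ∀ K : Finset (Fin (n - 1)),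
      (K.card : ℝ) ≤ b → (K.card : ℝ) * a ≤ ((hitVertices H φ K).card : ℝ)) := by
  set S : Finset (Finset (Fin (n - 1))) :=
    Finset.univ.filter fun K => K.Nonempty ∧ (K.card : ℝ) ≤ b
  set P : Finset (Sym2 (Fin n)) → (Sym2 (Fin n) → Fin (n - 1)) → Prop :=
    fun H φ => ∀ K : Finset (Fin (n - 1)),
      (K.card : ℝ) ≤ b → (K.card : ℝ) * a ≤ ((hitVertices H φ K).card : ℝ)
  have hpt : ∀ H φ, (1 : ℝ) ≤ (if P H φ then 1 else 0) +
      ∑ K ∈ S, y ^ (-(K.card * a)) * y ^ (hitVertices H φ K).card := by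
    intro H φ
    have hnn : ∀ K ∈ S, 0 ≤ y ^ (-(K.card * a)) * y ^ (hitVertices H φ K).card :=
      fun K _ => by positivity
    by_cases hP : P H φ
    · rw [if_pos hP]
      linarith [Finset.sum_nonneg hnn]
    · rw [if_neg hP, zero_add]
      simp only [P, not_forall, not_le] at hP
      obtain ⟨K, hK, hlt⟩ := hP
      have hne : K.Nonempty := by
        rw [Finset.nonempty_iff_ne_empty]
        rintro rfl
        rw [Finset.card_empty, Nat.cast_zero, zero_mul] at hlt
        exact (Nat.cast_nonneg _).not_gt hlt
      refine le_trans ?_ (Finset.single_le_sum hnn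
        (Finset.mem_filter.2 ⟨Finset.mem_univ K, hne, hK⟩))
      rw [← Real.rpow_natCast y, ← Real.rpow_add hy0]
      exact Real.one_le_rpow_of_pos_of_le_one_of_nonpos hy0 hy1 (by linarith)
  have h1 := expColored_mono hn hp0 hp1 (G := G) fun H φ _ => hpt H φ
  rw [expColored_one hn] at h1
  have h2 : expColored n G p (fun H φ => (if P H φ then 1 else 0) +
      ∑ K ∈ S, y ^ (-(K.card * a)) * y ^ (hitVertices H φ K).card) =
      prColored n G p P + ∑ K ∈ S, y ^ (-(K.card * a)) *
        expColored n G p (fun H φ => y ^ (hitVertices H φ K).card) := by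
    simp only [← expColored_const_mul]
    rw [← expColored_sum]
    simp only [expColored, prColored, mul_add, Finset.sum_add_distrib]
    congr!
  have h3 : ∑ K ∈ S, y ^ (-(K.card * a)) *
      expColored n G p (fun H φ => y ^ (hitVertices H φ K).card) ≤
      ∑ K : Finset (Fin (n - 1)) with K.Nonempty, z ^ K.card := by
    refine (Finset.sum_le_sum fun K hK => h K (Finset.mem_filter.1 hK).2.2).trans ?_
    refine Finset.sum_le_sum_of_subset_of_nonneg (fun K hK => ?_) fun K _ _ => by positivity
    simp only [S, Finset.mem_filter] at hK ⊢
    exact ⟨hK.1, hK.2.1⟩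
  linarith [sum_pow_card_nonempty_le (n - 1) hz]

lemma prColored_le_one {n : ℕ} (hn : 2 ≤ n) {G : SimpleGraph (Fin n)} {p : ℝ}
    (hp0 : 0 ≤ p) (hp1 : p ≤ 1)
    (P : Finset (Sym2 (Fin n)) → (Sym2 (Fin n) → Fin (n - 1)) → Prop) :
    prColored n G p P ≤ 1 := by
  rw [← expColored_one hn G p]
  refine expColored_mono hn hp0 hp1 (F := fun H φ => if P H φ then 1 else 0) fun H φ _ => ?_
  split_ifs <;> norm_num

/-- The moment bound for a single color set of size `k`. -/
lemma rpow_mul_exp_le {n k d : ℕ} {ε w y : ℝ} (hn : 2 ≤ n) (hd : 0 < d) (hε : 0 < ε)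
    (hw : 0 < w) (hy0 : 0 < y) (hy1 : y ≤ 1)
    (hrate : 1 + ε / 8 ≤ (1 - y) * (1 + ε / 4) / (1 + (4 + ε) / w) + Real.log y / w) :
    y ^ (-(k * (Real.log n / w))) *
      Real.exp (-((1 - y) * ((2 + ε / 2) * Real.log n / d * (k / (n - 1 : ℝ))) /
        (1 + (4 + ε) / w) * (n * d / 2))) ≤ ((n : ℝ) ^ (-(1 + ε / 8))) ^ k := by
  have hn' : (2 : ℝ) ≤ n := by exact_mod_cast hn
  have hd' : (0 : ℝ) < d := by exact_mod_cast hd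
  have hL : 0 ≤ Real.log n := Real.log_nonneg (by linarith)
  have hη : 0 < 1 + (4 + ε) / w := by positivity
  rw [Real.rpow_def_of_pos hy0, Real.rpow_def_of_pos (by linarith : (0 : ℝ) < n),
    ← Real.exp_nat_mul, ← Real.exp_add, Real.exp_le_exp]
  have h1 : (1 - y) * ((2 + ε / 2) * Real.log n / d * (k / (n - 1 : ℝ))) /
        (1 + (4 + ε) / w) * (n * d / 2) =
      (k * Real.log n) * ((1 - y) * (1 + ε / 4) / (1 + (4 + ε) / w)) * (n / (n - 1 : ℝ)) := by
    field_simp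
    ring
  have h2 : 1 ≤ (n : ℝ) / (n - 1) := by
    rw [one_le_div (by linarith)]; linarith
  have h3 : 0 ≤ (k * Real.log n) * ((1 - y) * (1 + ε / 4) / (1 + (4 + ε) / w)) :=
    mul_nonneg (by positivity)
      (div_nonneg (mul_nonneg (by linarith) (by linarith)) hη.le)
  have h4 := le_mul_of_one_le_right h3 h2
  have h5 := mul_le_mul_of_nonneg_left hrate (by positivity : 0 ≤ k * Real.log n)
  rw [h1]
  have h6 : Real.log y * -(k * (Real.log n / w)) = -(k * Real.log n * (Real.log y / w)) := by
    ring
  rw [h6]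
  nlinarith

lemma one_sub_le_prColored_hitVertices {n d : ℕ} {ε w y : ℝ} (hn : 2 ≤ n) (hd : 0 < d)
    (hε : 0 < ε) (hw : 0 < w) (hy0 : 0 < y) (hy1 : y ≤ 1) {G : SimpleGraph (Fin n)}
    (hG : G.IsRegularOfDegree d) (hp1 : (2 + ε / 2) * Real.log n / d ≤ 1)
    (hrate : 1 + ε / 8 ≤ (1 - y) * (1 + ε / 4) / (1 + (4 + ε) / w) + Real.log y / w) :
    2 - Real.exp ((n : ℝ) ^ (-(ε / 8))) ≤ prColored n G ((2 + ε / 2) * Real.log n / d)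
      (fun H φ => ∀ K : Finset (Fin (n - 1)), (K.card : ℝ) ≤ n / (w * Real.log n) →
        (K.card : ℝ) * (Real.log n / w) ≤ ((hitVertices H φ K).card : ℝ)) := by
  have hn' : (2 : ℝ) ≤ n := by exact_mod_cast hn
  have hd' : (0 : ℝ) < d := by exact_mod_cast hd
  have hL : 0 < Real.log n := Real.log_pos (by linarith)
  have hp0 : 0 ≤ (2 + ε / 2) * Real.log n / d := by positivity
  refine le_trans ?_ (one_sub_le_prColored hn hp0 hp1
    (z := (n : ℝ) ^ (-(1 + ε / 8))) (by positivity) hy0 hy1 fun K hK => ?_)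
  · have h1 : ((n - 1 : ℕ) : ℝ) ≤ n := by exact_mod_cast Nat.sub_le n 1
    have h2 : (n : ℝ) * (n : ℝ) ^ (-(1 + ε / 8)) = (n : ℝ) ^ (-(ε / 8)) := by
      nth_rewrite 1 [← Real.rpow_one (n : ℝ)]
      rw [← Real.rpow_add (by linarith)]
      ring_nf
    have h3 := mul_le_mul_of_nonneg_right h1
      (by positivity : 0 ≤ (n : ℝ) ^ (-(1 + ε / 8)))
    rw [h2] at h3
    linarith [Real.exp_le_exp.2 h3]
  · refine le_trans (mul_le_mul_of_nonneg_left
      (expColored_pow_card_hitVertices_le_exp hn hG hp0 hp1 K hy0.le hy1 (η := (4 + ε) / w) ?_)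
      (by positivity)) (rpow_mul_exp_le hn hd hε hw hy0 hy1 hrate)
    have hK' : K.card * Real.log n ≤ n / w := by
      have h := mul_le_mul_of_nonneg_right hK hL.le
      have h' : n / (w * Real.log n) * Real.log n = n / w := by field_simp
      rwa [h'] at h
    have h1 : (2 + ε / 2) * Real.log n / d * (K.card / (n - 1 : ℝ)) * d =
        (2 + ε / 2) / (n - 1) * (K.card * Real.log n) := by
      field_simp
    have h2 : 0 < (n : ℝ) - 1 := by linarith
    rw [h1]
    refine (mul_le_mul_of_nonneg_left hK' (by positivity)).trans ?_
    rw [div_mul_div_comm, div_le_div_iff₀ (by positivity) hw]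
    nlinarith [mul_pos hw hε]

/-- Let `ω` be an unbounded increasing function. If `G = G(n)` is `d`-regular on `n`
vertices with `d ≥ c·n` and `p = (2 + ε/2)·(log n)/d`, then a.a.s. the randomly colored
random subgraph `G_p` satisfies: for every color set `K` with
`|K| ≤ n/(ω(n)·log n)`, at least `|K|·(log n)/ω(n)` vertices are incident in `G_p`
to an edge whose color belongs to `K`. -/
theorem many_vertices_hit_by_color_sets_aas (ε c : ℝ) (hε : 0 < ε) (hc : 0 < c)
    (ω : ℕ → ℝ) (hω_mono : Monotone ω) (hω_unbdd : Tendsto ω atTop atTop)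
    (d : ℕ → ℕ) (G : ∀ n : ℕ, SimpleGraph (Fin n))
    (hG : ∀ᶠ n : ℕ in atTop,
      (G n).IsRegularOfDegree (d n) ∧ c * n ≤ (d n : ℝ)) :
    Tendsto (fun n : ℕ =>
        prColored n (G n) ((2 + ε / 2) * Real.log n / d n)
          (fun H φ => ∀ K : Finset (Fin (n - 1)),
            (K.card : ℝ) ≤ n / (ω n * Real.log n) →
            (K.card : ℝ) * Real.log n / ω n ≤
              ((Finset.univ.filter fun v : Fin n =>
                ∃ e ∈ H, v ∈ e ∧ φ e ∈ K).card : ℝ)))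
      atTop (nhds 1) := by
  have hcast : Tendsto (fun n : ℕ => (n : ℝ)) atTop atTop := tendsto_natCast_atTop_atTop
  set y : ℝ := (ε / 16) / (1 + ε / 4) with hy
  have hy0 : 0 < y := by positivity
  have hy1 : y ≤ 1 := by
    rw [hy, div_le_one (by positivity)]
    linarith
  have hyε : (1 - y) * (1 + ε / 4) = 1 + 3 * ε / 16 := by
    rw [hy]; field_simp; ring
  have hrate : ∀ᶠ n in atTop,
      1 + ε / 8 ≤ (1 - y) * (1 + ε / 4) / (1 + (4 + ε) / ω n) + Real.log y / ω n := by
    have h1 : Tendsto (fun n => (1 - y) * (1 + ε / 4) / (1 + (4 + ε) / ω n) + Real.log y / ω n)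
        atTop (nhds ((1 - y) * (1 + ε / 4) / (1 + 0) + 0)) :=
      (tendsto_const_nhds.div (tendsto_const_nhds.add (hω_unbdd.const_div_atTop _))
        (by norm_num)).add (hω_unbdd.const_div_atTop _)
    refine h1.eventually_const_le ?_
    rw [hyε]
    linarith
  have hp : ∀ᶠ n : ℕ in atTop, (2 + ε / 2) * Real.log n ≤ c * n := by
    have h := (Real.isLittleO_log_id_atTop.comp_tendsto hcast).bound
      (by positivity : 0 < c / (2 + ε / 2))
    filter_upwards [h, eventually_ge_atTop 1] with n hn hn1
    have hL : 0 ≤ Real.log n := Real.log_nonneg (by exact_mod_cast hn1)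
    simp only [Function.comp_apply, id, Real.norm_eq_abs, abs_of_nonneg hL, Nat.abs_cast] at hn
    rw [div_mul_eq_mul_div, le_div_iff₀ (by positivity)] at hn
    linarith
  have hlow : Tendsto (fun n : ℕ => 2 - Real.exp ((n : ℝ) ^ (-(ε / 8)))) atTop (nhds 1) := by
    have h1 : Tendsto (fun n : ℕ => (n : ℝ) ^ (-(ε / 8))) atTop (nhds 0) :=
      (tendsto_rpow_neg_atTop (by positivity)).comp hcast
    have h2 := ((Real.continuous_exp.tendsto 0).comp h1).const_sub 2
    rw [Real.exp_zero] at h2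
    norm_num at h2
    exact h2
  refine tendsto_of_tendsto_of_tendsto_of_le_of_le' hlow tendsto_const_nhds ?_ ?_
  all_goals
    filter_upwards [hrate, hp, hG, eventually_ge_atTop 2, hω_unbdd.eventually_gt_atTop 0]
      with n hrate hp hG hn hω
    have hn' : (2 : ℝ) ≤ n := by exact_mod_cast hn
    have hcn : 0 < c * n := by positivity
    have hd : (0 : ℝ) < d n := hcn.trans_le hG.2
    have hp1 : (2 + ε / 2) * Real.log n / d n ≤ 1 := by
      rw [div_le_one hd]
      exact hp.trans hG.2
  · simp only [mul_div_assoc]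
    simpa only [mul_div_assoc, hitVertices] using one_sub_le_prColored_hitVertices hn (by exact_mod_cast hd)
      hε hω hy0 hy1 hG.1 hp1 hrate
  · have hL : 0 ≤ Real.log n := Real.log_nonneg (by linarith)
    exact prColored_le_one hn (by positivity) hp1 _
end

section
/- Let ω(n) = (1/3)·log log log n. There exists n₀ such that for all n ≥ n₀ the following holds. Let G be a graph on n vertices with an edge-coloring φ : E(G) → {1, …, n−1} satisfying: for every color set K ⊆ {1, …, n−1} with |K| ≤ n/(ω(n)·log n), at least |K|·(log n)/e^{ω(n)} vertices of G are incident to at least one edge whose color belongs to K. Let F* be a rainbow forest in G with at most n − 2 edges such that G contains no rainbow forest with |E(F*)| + 1 edges, and let σ ∈ {1, …, n−1} \ φ(E(F*)). Let J ⊆ φ(E(F*)) ∪ {σ} denote the set of colors j for which there exists a rainbow forest F in G satisfying: (i) the connected components of F partition V(G) in the same way as the connected components of F*, and (ii) φ(E(F)) = (φ(E(F*)) ∪ {σ}) \ {j}. Then |J| ≥ n/(log log n). -/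
open Finset SimpleGraph
open scoped Classical

/-- `ω(n) = (1/3)·log log log n`. -/
noncomputable def omg (n : ℕ) : ℝ := Real.log (Real.log (Real.log n)) / 3

/-- The dimension of the span of the vectors indexed by a finite set. -/
noncomputable def vecRank {E W : Type*} [AddCommGroup W] [Module (ZMod 2) W] (f : E → W)
    (S : Finset E) : ℕ :=
  Module.finrank (ZMod 2) (Submodule.span (ZMod 2) (f '' (S : Set E)))

section Rank

variable {E W : Type*} [AddCommGroup W] [Module (ZMod 2) W] (f : E → W)

lemma vecRank_le_card (S : Finset E) : vecRank f S ≤ S.card := by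
  have h := finrank_span_finset_le_card (R := ZMod 2) (S.image f)
  rw [Set.finrank, Finset.coe_image] at h
  exact h.trans Finset.card_image_le

lemma linearIndepOn_iff_card_le_vecRank (S : Finset E) :
    LinearIndepOn (ZMod 2) f (S : Set E) ↔ S.card ≤ vecRank f S := by
  rw [LinearIndepOn, linearIndependent_iff_card_le_finrank_span, Set.finrank, vecRank,
    Set.image_eq_range]
  simp

variable [FiniteDimensional (ZMod 2) W]

lemma vecRank_mono {S T : Finset E} (h : S ⊆ T) : vecRank f S ≤ vecRank f T :=
  Submodule.finrank_mono (Submodule.span_mono (Set.image_mono (by exact_mod_cast h)))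

variable [DecidableEq E]

lemma vecRank_union_add_vecRank_inter_le (S T : Finset E) :
    vecRank f (S ∪ T) + vecRank f (S ∩ T) ≤ vecRank f S + vecRank f T := by
  have h := Submodule.finrank_sup_add_finrank_inf_eq
    (Submodule.span (ZMod 2) (f '' (S : Set E))) (Submodule.span (ZMod 2) (f '' (T : Set E)))
  unfold vecRank
  rw [← h, ← Submodule.span_union, ← Set.image_union, ← Finset.coe_union]
  gcongr
  refine Submodule.finrank_mono (le_inf ?_ ?_) <;>
    exact Submodule.span_mono (Set.image_mono (by simp))

/-- Rado's theorem on independent transversals, for the color classes of a coloring `φ` of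
vectors `f e`: if the edges of `A` with color in `L` have rank at least `L.card` for all `L ⊆ K`,
then `A` has an independent subset using each color of `K` exactly once. -/
theorem exists_rainbow_independent {C : Type*} [DecidableEq C] (φ : E → C)
    (K : Finset C) (A : Finset E)
    (hA : ∀ L ⊆ K, L.card ≤ vecRank f (A.filter fun e => φ e ∈ L)) :
    ∃ T ⊆ A, T.card ≤ vecRank f T ∧ Set.InjOn φ (T : Set E) ∧ T.image φ = K := by
  induction A using Finset.strongInduction with
  | H A ih =>
    by_cases hinj : Set.InjOn φ (A.filter fun e => φ e ∈ K : Finset E)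
    · have h1 := hA K subset_rfl
      have h2 := vecRank_le_card f (A.filter fun e => φ e ∈ K)
      have h3 := Finset.card_image_of_injOn hinj
      have hsub : (A.filter fun e => φ e ∈ K).image φ ⊆ K := by
        intro c hc
        simp only [Finset.mem_image, Finset.mem_filter] at hc
        obtain ⟨e, ⟨-, he⟩, rfl⟩ := hc
        exact he
      have h4 := Finset.card_le_card hsub
      exact ⟨_, Finset.filter_subset _ _, by omega, hinj,
        Finset.eq_of_subset_of_card_le hsub (by omega)⟩
    · simp only [Set.InjOn, Finset.mem_coe, Finset.mem_filter] at hinj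
      push Not at hinj
      obtain ⟨x, ⟨hxA, hxK⟩, y, ⟨hyA, -⟩, hxy, hne⟩ := hinj
      by_contra hcon
      have key : ∀ z ∈ A, φ z = φ x → ∃ L ⊆ K, φ x ∉ L ∧
          vecRank f ((A.erase z).filter fun e => φ e ∈ insert (φ x) L) ≤ L.card := by
        intro z hz hzx
        by_contra hno
        push Not at hno
        apply hcon
        obtain ⟨T, hT, h⟩ := ih (A.erase z) (Finset.erase_ssubset hz) (by
          intro L hL
          by_cases hxL : φ x ∈ L
          · have := hno (L.erase (φ x)) ((Finset.erase_subset _ _).trans hL) (by simp)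
            rw [Finset.insert_erase hxL] at this
            rw [← Finset.insert_erase hxL, Finset.card_insert_of_notMem (by simp),
              Finset.insert_erase hxL]
            exact this
          · convert hA L hL using 2
            ext e
            simp only [Finset.mem_filter, Finset.mem_erase]
            constructor
            · tauto
            · rintro ⟨h1, h2⟩
              refine ⟨⟨?_, h1⟩, h2⟩
              rintro rfl
              exact hxL (hzx ▸ h2))
        exact ⟨T, hT.trans (Finset.erase_subset _ _), h⟩
      obtain ⟨L, hLK, hxL, hL⟩ := key x hxA rfl
      obtain ⟨M, hMK, hxM, hM⟩ := key y hyA hxy.symm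
      have hsub := vecRank_union_add_vecRank_inter_le f
        ((A.erase x).filter fun e => φ e ∈ insert (φ x) L)
        ((A.erase y).filter fun e => φ e ∈ insert (φ x) M)
      have hU : vecRank f (A.filter fun e => φ e ∈ insert (φ x) (L ∪ M)) ≤ _ :=
        vecRank_mono f (T := ((A.erase x).filter fun e => φ e ∈ insert (φ x) L) ∪
          ((A.erase y).filter fun e => φ e ∈ insert (φ x) M)) (by
          intro e
          simp only [Finset.mem_filter, Finset.mem_union, Finset.mem_erase, Finset.mem_insert]
          by_cases h1 : e = x
          · subst h1
            simp [hne]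
          · by_cases h2 : e = y
            · subst h2
              simp [h1, hxy]
            · tauto)
      have hI : vecRank f (A.filter fun e => φ e ∈ L ∩ M) ≤ _ :=
        vecRank_mono f (T := ((A.erase x).filter fun e => φ e ∈ insert (φ x) L) ∩
          ((A.erase y).filter fun e => φ e ∈ insert (φ x) M)) (by
          intro e
          simp only [Finset.mem_filter, Finset.mem_inter, Finset.mem_erase, Finset.mem_insert]
          rintro ⟨h1, h2, h3⟩
          refine ⟨⟨⟨?_, h1⟩, Or.inr h2⟩, ⟨?_, h1⟩, Or.inr h3⟩
          · rintro rfl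
            exact hxL h2
          · rintro rfl
            exact hxL (hxy ▸ h2))
      have h1 := hA (insert (φ x) (L ∪ M)) (Finset.insert_subset hxK (Finset.union_subset hLK hMK))
      have h2 := hA (L ∩ M) (Finset.inter_subset_left.trans hLK)
      rw [Finset.card_insert_of_notMem (by simp [hxL, hxM])] at h1
      have h3 := Finset.card_union_add_card_inter L M
      omega

end Rank

section Graphic

variable {V : Type*} [DecidableEq V]

/-- The mod-2 incidence vector of an edge (zero for loops). -/
def incVec : Sym2 V → V → ZMod 2 :=
  Sym2.lift ⟨fun u v => Pi.single u 1 + Pi.single v 1, fun _ _ => add_comm _ _⟩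

lemma incVec_mk (u v : V) : incVec s(u, v) = Pi.single u 1 + Pi.single v 1 := rfl

lemma incVec_apply_of_notMem {e : Sym2 V} {v : V} (h : v ∉ e) : incVec e v = 0 := by
  induction e with
  | h a b =>
    simp only [Sym2.mem_iff, not_or] at h
    simp [incVec_mk, h.1, h.2]

lemma incVec_apply_of_mem {e : Sym2 V} {v : V} (hd : ¬ e.IsDiag) (h : v ∈ e) :
    incVec e v = 1 := by
  induction e with
  | h a b =>
    simp only [Sym2.mem_iff, Sym2.mk_isDiag_iff] at h hd
    rcases h with rfl | rfl
    · simp [incVec_mk, hd]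
    · simp [incVec_mk, Ne.symm hd]

lemma incVec_mem_span_iff_reachable [Fintype V] (S : Set (Sym2 V)) (u v : V) :
    incVec s(u, v) ∈ Submodule.span (ZMod 2) (incVec '' S) ↔
      (SimpleGraph.fromEdgeSet S).Reachable u v := by
  constructor
  · intro h
    by_contra hr
    let c : V → ZMod 2 := fun w => if (SimpleGraph.fromEdgeSet S).Reachable u w then 1 else 0
    let ℓ : (V → ZMod 2) →ₗ[ZMod 2] ZMod 2 := Fintype.linearCombination (ZMod 2) c
    have hℓ : ∀ a b : V, ℓ (incVec s(a, b)) = c a + c b := by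
      intro a b
      simp [ℓ, incVec_mk, map_add, Fintype.linearCombination_apply_single]
    have hle : Submodule.span (ZMod 2) (incVec '' S) ≤ LinearMap.ker ℓ := by
      rw [Submodule.span_le]
      rintro _ ⟨e, he, rfl⟩
      induction e with
      | h a b =>
        have hab : c a = c b := by
          by_cases hne : a = b
          · rw [hne]
          · have hadj : (SimpleGraph.fromEdgeSet S).Reachable a b :=
              SimpleGraph.Adj.reachable (by simp [he, hne])
            have : (SimpleGraph.fromEdgeSet S).Reachable u a ↔
                (SimpleGraph.fromEdgeSet S).Reachable u b :=
              ⟨fun h => h.trans hadj, fun h => h.trans hadj.symm⟩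
            simp [c, this]
        simp only [SetLike.mem_coe, LinearMap.mem_ker, hℓ, hab]
        exact CharTwo.add_self_eq_zero _
    have h0 := hle h
    rw [LinearMap.mem_ker, hℓ] at h0
    simp [c, hr] at h0
  · rintro ⟨p⟩
    induction p with
    | @nil u =>
      have h : incVec s(u, u) = 0 := by
        ext w
        exact CharTwo.add_self_eq_zero _
      rw [h]
      exact zero_mem _
    | @cons a b d hab p ih =>
      have h1 : incVec s(a, b) ∈ Submodule.span (ZMod 2) (incVec '' S) :=
        Submodule.subset_span ⟨_, ((SimpleGraph.fromEdgeSet_adj S).1 hab).1, rfl⟩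
      have h2 : incVec s(a, d) = incVec s(a, b) + incVec s(b, d) := by
        have h3 : (Pi.single b 1 + Pi.single b 1 : V → ZMod 2) = 0 := by
          ext w
          exact CharTwo.add_self_eq_zero _
        simp only [incVec_mk]
        rw [add_assoc, ← add_assoc (Pi.single b 1) (Pi.single b 1), h3, zero_add]
      rw [h2]
      exact add_mem h1 ih

lemma isAcyclic_fromEdgeSet_iff [Fintype V] (S : Finset (Sym2 V)) (hS : ∀ e ∈ S, ¬ e.IsDiag) :
    (SimpleGraph.fromEdgeSet (S : Set (Sym2 V))).IsAcyclic ↔ S.card ≤ vecRank incVec S := by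
  rw [← linearIndepOn_iff_card_le_vecRank, SimpleGraph.isAcyclic_iff_forall_isBridge,
    linearIndepOn_iff_notMem_span]
  have hE : ∀ e, e ∈ (SimpleGraph.fromEdgeSet (S : Set (Sym2 V))).edgeSet ↔ e ∈ (S : Set _) := by
    intro e
    simp only [SimpleGraph.edgeSet_fromEdgeSet, Set.mem_sdiff, Finset.mem_coe]
    exact ⟨fun h => h.1, fun h => ⟨h, hS e h⟩⟩
  refine forall_congr' fun e => ?_
  rw [hE]
  refine imp_congr_right fun he => ?_
  induction e with
  | h u v =>
    rw [incVec_mem_span_iff_reachable, SimpleGraph.isBridge_iff,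
      SimpleGraph.deleteEdges, SimpleGraph.fromEdgeSet_sdiff]

/-- Every vertex covered by a set of edges is covered by any spanning subfamily. -/
lemma card_covered_le [Fintype V] (A B : Finset (Sym2 V)) (hA : ∀ e ∈ A, ¬ e.IsDiag)
    (hAB : ∀ e ∈ A, incVec e ∈ Submodule.span (ZMod 2) (incVec '' (B : Set (Sym2 V)))) :
    (Finset.univ.filter fun v : V => ∃ e ∈ A, v ∈ e).card ≤ 2 * B.card := by
  have hsub : (Finset.univ.filter fun v : V => ∃ e ∈ A, v ∈ e) ⊆ B.biUnion Sym2.toFinset := by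
    intro v hv
    simp only [Finset.mem_filter, Finset.mem_univ, true_and] at hv
    obtain ⟨e, he, hve⟩ := hv
    by_contra hno
    simp only [Finset.mem_biUnion, Sym2.mem_toFinset, not_exists, not_and] at hno
    have hle : Submodule.span (ZMod 2) (incVec '' (B : Set (Sym2 V))) ≤
        LinearMap.ker (LinearMap.proj (R := ZMod 2) (φ := fun _ : V => ZMod 2) v) := by
      rw [Submodule.span_le]
      rintro _ ⟨b, hb, rfl⟩
      exact incVec_apply_of_notMem (hno b hb)
    have h0 : incVec e v = 0 := hle (hAB e he)
    rw [incVec_apply_of_mem (hA e he) hve] at h0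
    exact one_ne_zero h0
  calc _ ≤ _ := Finset.card_le_card hsub
    _ ≤ ∑ b ∈ B, (Sym2.toFinset b).card := Finset.card_biUnion_le
    _ ≤ ∑ b ∈ B, 2 := Finset.sum_le_sum fun b _ => by
        rw [Sym2.card_toFinset]
        split_ifs <;> omega
    _ = 2 * B.card := by simp [mul_comm]

end Graphic

/-- A maximum rainbow forest and an unused color determine a set of exchangeable colors whose
edges cover fewer than twice as many vertices as there are colors. -/
theorem exists_exchangeable_colors {V C : Type*} [Fintype V] [DecidableEq V] [DecidableEq C]
    (G : SimpleGraph V) [Fintype G.edgeSet] (φ : Sym2 V → C) (F : Finset (Sym2 V))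
    (hFG : F ⊆ G.edgeFinset)
    (hF : (SimpleGraph.fromEdgeSet (F : Set (Sym2 V))).IsAcyclic) (hφ : Set.InjOn φ ↑F)
    (hmax : ¬ ∃ T ⊆ G.edgeFinset, (SimpleGraph.fromEdgeSet (T : Set (Sym2 V))).IsAcyclic ∧
      Set.InjOn φ ↑T ∧ T.card = F.card + 1)
    (σ : C) (hσ : σ ∉ F.image φ) :
    ∃ K : Finset C,
      (∀ j ∈ K, ∃ T ⊆ G.edgeFinset,
        (SimpleGraph.fromEdgeSet (T : Set (Sym2 V))).IsAcyclic ∧ Set.InjOn φ ↑T ∧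
        (∀ u v : V, (SimpleGraph.fromEdgeSet (T : Set (Sym2 V))).Reachable u v ↔
          (SimpleGraph.fromEdgeSet (F : Set (Sym2 V))).Reachable u v) ∧
        T.image φ = (insert σ (F.image φ)).erase j) ∧
      (Finset.univ.filter fun v : V => ∃ e ∈ G.edgeFinset, v ∈ e ∧ φ e ∈ K).card <
        2 * K.card := by
  have hdiag : ∀ T ⊆ G.edgeFinset, ∀ e ∈ T, ¬ e.IsDiag := fun T hT e he =>
    G.not_isDiag_of_mem_edgeSet (SimpleGraph.mem_edgeFinset.1 (hT he))
  have hFr := (isAcyclic_fromEdgeSet_iff F (hdiag F hFG)).1 hF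
  set D := insert σ (F.image φ) with hD
  have hDc : D.card = F.card + 1 := by
    rw [hD, Finset.card_insert_of_notMem hσ, Finset.card_image_of_injOn hφ]
  let col : Finset C → Finset (Sym2 V) := fun L => G.edgeFinset.filter fun e => φ e ∈ L
  have hbad : ∃ K ⊆ D, vecRank incVec (col K) < K.card := by
    by_contra hno
    push Not at hno
    obtain ⟨T, hT, h1, h2, h3⟩ := exists_rainbow_independent incVec φ D G.edgeFinset hno
    exact hmax ⟨T, hT, (isAcyclic_fromEdgeSet_iff T (hdiag T hT)).2 h1, h2, by
      rw [← hDc, ← h3, Finset.card_image_of_injOn h2]⟩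
  obtain ⟨K, hKmem, hKmin⟩ := Finset.exists_min_image
    (D.powerset.filter fun K => vecRank incVec (col K) < K.card) Finset.card (by
      obtain ⟨K, h1, h2⟩ := hbad
      exact ⟨K, by simp [h1, h2]⟩)
  simp only [Finset.mem_filter, Finset.mem_powerset] at hKmem hKmin
  obtain ⟨hKD, hKr⟩ := hKmem
  set FK := F.filter fun e => φ e ∈ K with hFK
  set FN := F.filter fun e => φ e ∉ K with hFN
  have hsplit : FK ∪ FN = F := Finset.filter_union_filter_not_eq _ _
  have hcards : FK.card + FN.card = F.card := Finset.card_filter_add_card_filter_not _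
  have hFKind : FK.card ≤ vecRank incVec FK := by
    rw [← linearIndepOn_iff_card_le_vecRank] at hFr ⊢
    exact hFr.mono (Finset.coe_subset.2 (Finset.filter_subset _ _))
  have hFKcol : FK ⊆ col K := Finset.filter_subset_filter _ hFG
  have hFKr := vecRank_mono incVec hFKcol
  have hFKimg : FK.image φ = K.erase σ := by
    ext c
    simp only [hFK, Finset.mem_image, Finset.mem_filter, Finset.mem_erase]
    constructor
    · rintro ⟨e, ⟨he, heK⟩, rfl⟩
      exact ⟨fun h => hσ (h ▸ Finset.mem_image_of_mem φ he), heK⟩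
    · rintro ⟨hc, hcK⟩
      have := hKD hcK
      simp only [hD, Finset.mem_insert, Finset.mem_image, hc, false_or] at this
      obtain ⟨e, he, rfl⟩ := this
      exact ⟨e, ⟨he, hcK⟩, rfl⟩
  have hFKinj : Set.InjOn φ (FK : Set (Sym2 V)) :=
    hφ.mono (Finset.coe_subset.2 (Finset.filter_subset _ _))
  have hFKc : FK.card = (K.erase σ).card := by rw [← hFKimg, Finset.card_image_of_injOn hFKinj]
  have hKpos : 0 < K.card := by omega
  have hKe := Finset.pred_card_le_card_erase (s := K) (a := σ)
  have hspan : ∀ T ⊆ col K, T.card ≤ vecRank incVec T → T.card = K.card - 1 →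
      Submodule.span (ZMod 2) (incVec '' (T : Set (Sym2 V))) =
        Submodule.span (ZMod 2) (incVec '' (col K : Set (Sym2 V))) := by
    intro T hT h1 h2
    refine Submodule.eq_of_le_of_finrank_le
      (Submodule.span_mono (Set.image_mono (by exact_mod_cast hT))) ?_
    change vecRank incVec (col K) ≤ vecRank incVec T
    omega
  have hFKspan := hspan FK hFKcol hFKind (by omega)
  refine ⟨K, ?_, ?_⟩
  · intro j hj
    obtain ⟨S, hSG, hSr, hSinj, hSimg⟩ := exists_rainbow_independent incVec φ (K.erase j)
      G.edgeFinset (by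
        intro L hL
        by_contra hlt
        have h1 := hKmin L ⟨hL.trans ((Finset.erase_subset _ _).trans hKD), not_le.1 hlt⟩
        have h2 := Finset.card_le_card hL
        rw [Finset.card_erase_of_mem hj] at h2
        omega)
    have hSc : S.card = K.card - 1 := by
      rw [← Finset.card_image_of_injOn hSinj, hSimg, Finset.card_erase_of_mem hj]
    have hScol : S ⊆ col K := by
      intro e he
      have : φ e ∈ K.erase j := hSimg ▸ Finset.mem_image_of_mem φ he
      simp [col, SimpleGraph.mem_edgeFinset.1 (hSG he), Finset.mem_of_mem_erase this]
    have hSspan := hspan S hScol hSr hSc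
    have hTspan : Submodule.span (ZMod 2) (incVec '' ((S ∪ FN : Finset _) : Set (Sym2 V))) =
        Submodule.span (ZMod 2) (incVec '' (F : Set (Sym2 V))) := by
      conv_rhs => rw [← hsplit]
      simp only [Finset.coe_union, Set.image_union, Submodule.span_union, hSspan, hFKspan]
    have hTG : S ∪ FN ⊆ G.edgeFinset :=
      Finset.union_subset hSG ((Finset.filter_subset _ _).trans hFG)
    have hTc : (S ∪ FN).card ≤ F.card := (Finset.card_union_le _ _).trans (by omega)
    have hTimg : (S ∪ FN).image φ = D.erase j := by
      rw [Finset.image_union, hSimg]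
      ext c
      simp only [hFN, Finset.mem_union, Finset.mem_erase, Finset.mem_image, Finset.mem_filter]
      constructor
      · rintro (⟨h1, h2⟩ | ⟨e, ⟨he, heK⟩, rfl⟩)
        · exact ⟨h1, hKD h2⟩
        · exact ⟨fun h => heK (h ▸ hj), by simp [hD]; exact Or.inr ⟨e, he, rfl⟩⟩
      · rintro ⟨h1, h2⟩
        by_cases hc : c ∈ K
        · exact Or.inl ⟨h1, hc⟩
        · have hcσ : c ≠ σ := by
            rintro rfl
            rw [Finset.erase_eq_of_notMem hc] at hFKc
            omega
          simp only [hD, Finset.mem_insert, Finset.mem_image, hcσ, false_or] at h2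
          obtain ⟨e, he, rfl⟩ := h2
          exact Or.inr ⟨e, ⟨he, hc⟩, rfl⟩
    refine ⟨S ∪ FN, hTG, (isAcyclic_fromEdgeSet_iff _ (hdiag _ hTG)).2 ?_, ?_, ?_, hTimg⟩
    · rw [vecRank, hTspan]
      exact hTc.trans hFr
    · rw [← Finset.card_image_iff]
      refine le_antisymm Finset.card_image_le ?_
      rw [hTimg, Finset.card_erase_of_mem (hKD hj), hDc]
      omega
    · intro u v
      rw [← incVec_mem_span_iff_reachable, ← incVec_mem_span_iff_reachable, hTspan]
  · have h := card_covered_le (col K) FK (hdiag _ (Finset.filter_subset _ _)) (by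
      intro e he
      rw [hFKspan]
      exact Submodule.subset_span ⟨e, he, rfl⟩)
    have heq : (Finset.univ.filter fun v : V => ∃ e ∈ G.edgeFinset, v ∈ e ∧ φ e ∈ K) =
        Finset.univ.filter fun v : V => ∃ e ∈ col K, v ∈ e := by
      ext v
      simp only [col, Finset.mem_filter, Finset.mem_univ, true_and]
      exact exists_congr fun e => by tauto
    rw [heq]
    omega

lemma eventually_four_le_omg :
    ∀ᶠ n : ℕ in Filter.atTop, 0 < Real.log (Real.log n) ∧ 4 ≤ omg n := by
  have h : Filter.Tendsto (fun n : ℕ => Real.log (Real.log n)) Filter.atTop Filter.atTop :=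
    Real.tendsto_log_atTop.comp (Real.tendsto_log_atTop.comp tendsto_natCast_atTop_atTop)
  exact (h.eventually_gt_atTop 0).and
    (((Real.tendsto_log_atTop.comp h).atTop_div_const (by norm_num)).eventually_ge_atTop 4)

/-- Size estimates for the iterated logarithms of `n` when `omg n` is at least `4`. -/
lemma omg_estimates {n : ℕ} (hl : 0 < Real.log (Real.log n)) (h : 4 ≤ omg n) :
    2 ≤ Real.log n / Real.exp (omg n) ∧ 0 < Real.log n ∧
      omg n * Real.log n ≤ n ∧ 4 * (omg n * Real.exp (omg n)) ≤ Real.log (Real.log n) := by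
  set w := omg n with hw
  have hlog : Real.log (Real.log (Real.log n)) = 3 * w := by rw [hw, omg]; ring
  have hL : 0 < Real.log n := by
    refine lt_of_le_of_ne (Real.log_natCast_nonneg n) fun h0 => ?_
    rw [← h0] at hl
    simp at hl
  have hn : (0 : ℝ) < n := by
    refine lt_of_le_of_ne (Nat.cast_nonneg n) fun h0 => ?_
    rw [← h0] at hL
    simp at hL
  have ht : w + 1 ≤ Real.exp w := Real.add_one_le_exp w
  have hlt : Real.log (Real.log n) = Real.exp w ^ 3 := by
    rw [← Real.exp_log hl, hlog, ← Real.exp_nat_mul]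
    norm_num
  have hlL : Real.log (Real.log n) + 1 ≤ Real.log n := by
    simpa [Real.exp_log hL] using Real.add_one_le_exp (Real.log (Real.log n))
  have hLn : Real.log n ^ 2 / 2 ≤ n := by
    have := Real.quadratic_le_exp_of_nonneg hL.le
    rw [Real.exp_log hn] at this
    linarith
  rw [hlt] at hlL ⊢
  set t := Real.exp w
  have ht5 : 5 ≤ t := by linarith
  have h25 : 25 ≤ t ^ 2 := by nlinarith
  have ht3 : 25 * t ≤ t ^ 3 := by nlinarith
  refine ⟨?_, hL, ?_, ?_⟩
  · rw [le_div_iff₀ (by linarith)]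
    linarith
  · nlinarith
  · nlinarith [mul_nonneg (by linarith : 0 ≤ t) (by linarith : 0 ≤ t - 1 - w)]

/-- A lower bound on the size of a color set covering few vertices. -/
lemma div_log_log_le_card {n : ℕ} (hl : 0 < Real.log (Real.log n)) (h : 4 ≤ omg n)
    {C : Type*} (g : Finset C → ℕ) (hmono : Monotone g)
    (hg : ∀ K : Finset C, (K.card : ℝ) ≤ n / (omg n * Real.log n) →
      (K.card : ℝ) * Real.log n / Real.exp (omg n) ≤ g K)
    (K : Finset C) (hK : g K < 2 * K.card) :
    (n : ℝ) / Real.log (Real.log n) ≤ K.card := by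
  obtain ⟨h1, hL, h2, h3⟩ := omg_estimates hl h
  have hE := Real.exp_pos (omg n)
  have hw : 0 < omg n := by linarith
  have hKr : (g K : ℝ) < 2 * K.card := by exact_mod_cast hK
  by_cases hle : (K.card : ℝ) ≤ n / (omg n * Real.log n)
  · have := hg K hle
    rw [mul_div_assoc] at this
    nlinarith [(Nat.cast_nonneg K.card : (0 : ℝ) ≤ K.card)]
  · push Not at hle
    set x := (n : ℝ) / (omg n * Real.log n) with hx
    have hx1 : 1 ≤ x := by rw [hx, le_div_iff₀ (by positivity)]; linarith
    obtain ⟨L, hLK, hLc⟩ := Finset.exists_subset_card_eq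
      (s := K) (n := ⌊x⌋₊) (by
        have := Nat.floor_le (zero_le_one.trans hx1)
        exact_mod_cast this.trans hle.le)
    have hfl : x / 2 ≤ (⌊x⌋₊ : ℝ) := by
      have h4 := Nat.lt_floor_add_one x
      have h5 : (1 : ℝ) ≤ ⌊x⌋₊ := by exact_mod_cast (Nat.one_le_floor_iff x).2 hx1
      linarith
    have h6 := hg L (by rw [hLc]; exact Nat.floor_le (zero_le_one.trans hx1))
    have h7 : (g L : ℝ) ≤ g K := by exact_mod_cast hmono hLK
    rw [hLc, mul_div_assoc] at h6
    have h8 : x / 2 * (Real.log n / Real.exp (omg n)) ≤ 2 * K.card := by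
      have := mul_le_mul_of_nonneg_right hfl (by linarith : 0 ≤ Real.log n / Real.exp (omg n))
      linarith
    have h9 : x / 2 * (Real.log n / Real.exp (omg n)) =
        2 * (n / (4 * (omg n * Real.exp (omg n)))) := by
      rw [hx]
      field_simp
      norm_num
    have h10 : (n : ℝ) / Real.log (Real.log n) ≤ n / (4 * (omg n * Real.exp (omg n))) :=
      div_le_div_of_nonneg_left (by positivity) (by positivity) h3
    linarith

/-- Edge-replacement lemma: if `G` on `n` vertices (edge-colored with colors `Fin (n-1)`)
satisfies the vertex-incidence condition for small color sets, `F` is a rainbow forest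
in `G` with at most `n − 2` edges such that `G` has no rainbow forest with `|E(F)| + 1`
edges, and `σ` is a color not used by `F`, then the set `J` of colors `j` for which some
rainbow forest of `G` inducing the same vertex partition as `F` has color set
`(φ(E(F)) ∪ {σ}) \ {j}` has at least `n / log log n` elements. -/
theorem many_replacement_colors :
    ∃ n₀ : ℕ, ∀ n : ℕ, n₀ ≤ n →
    ∀ (G : SimpleGraph (Fin n)) (φ : Sym2 (Fin n) → Fin (n - 1)),
      (∀ K : Finset (Fin (n - 1)), (K.card : ℝ) ≤ n / (omg n * Real.log n) →
        (K.card : ℝ) * Real.log n / Real.exp (omg n) ≤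
          ((Finset.univ.filter fun v : Fin n =>
            ∃ e ∈ G.edgeFinset, v ∈ e ∧ φ e ∈ K).card : ℝ)) →
      ∀ F : Finset (Sym2 (Fin n)),
        F ⊆ G.edgeFinset →
        (SimpleGraph.fromEdgeSet (F : Set (Sym2 (Fin n)))).IsAcyclic →
        Set.InjOn φ ↑F →
        F.card ≤ n - 2 →
        (¬ ∃ T ⊆ G.edgeFinset,
          (SimpleGraph.fromEdgeSet (T : Set (Sym2 (Fin n)))).IsAcyclic ∧
          Set.InjOn φ ↑T ∧ T.card = F.card + 1) →
        ∀ σ : Fin (n - 1), σ ∉ F.image φ →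
        (n : ℝ) / Real.log (Real.log n) ≤
          ((Finset.univ.filter fun j : Fin (n - 1) =>
            ∃ T ⊆ G.edgeFinset,
              (SimpleGraph.fromEdgeSet (T : Set (Sym2 (Fin n)))).IsAcyclic ∧
              Set.InjOn φ ↑T ∧
              (∀ u v : Fin n,
                (SimpleGraph.fromEdgeSet (T : Set (Sym2 (Fin n)))).Reachable u v ↔
                (SimpleGraph.fromEdgeSet (F : Set (Sym2 (Fin n)))).Reachable u v) ∧
              T.image φ = (insert σ (F.image φ)).erase j).card : ℝ) := by
  obtain ⟨n₀, hn₀⟩ := Filter.eventually_atTop.1 eventually_four_le_omg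
  refine ⟨n₀, fun n hn G φ hG F hFG hF hφ _ hmax σ hσ => ?_⟩
  obtain ⟨K, hKJ, hK⟩ := exists_exchangeable_colors G φ F hFG hF hφ hmax σ hσ
  let g : Finset (Fin (n - 1)) → ℕ := fun K =>
    (Finset.univ.filter fun v : Fin n => ∃ e ∈ G.edgeFinset, v ∈ e ∧ φ e ∈ K).card
  have hmono : Monotone g := by
    intro L M hLM
    refine Finset.card_le_card fun v hv => ?_
    simp only [Finset.mem_filter, Finset.mem_univ, true_and] at hv ⊢
    obtain ⟨e, h1, h2, h3⟩ := hv
    exact ⟨e, h1, h2, hLM h3⟩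
  have hgK : g K < 2 * K.card := by
    convert hK
  refine (div_log_log_le_card (hn₀ n hn).1 (hn₀ n hn).2 g hmono hG K hgK).trans ?_
  refine Nat.cast_le.2 (Finset.card_le_card fun j hj => ?_)
  rw [Finset.mem_filter]
  exact ⟨Finset.mem_univ _, hKJ j hj⟩
end

section
/- Let G be a graph on vertex set V with an edge-coloring φ, and let F be a rainbow forest in G such that G contains no rainbow forest with |E(F)| + 1 edges. Let j be a color with j ∉ φ(E(F)), and let E_j be the set of edges of G with color j. Then every edge of E_j has both endpoints in the same component of F, and the set R = { r ∈ E(F) : r is replaceable by some edge of E_j } is an edge cover of the set of vertices incident to edges of E_j; that is, every vertex incident to an edge of E_j is incident to an edge of R. Consequently, |R| ≥ (1/2)·|V(E_j)|, where V(E_j) is the set of vertices incident to an edge of E_j. -/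
open Finset SimpleGraph
open scoped Classical

/-- For a forest with edge set `F`, the edge `r ∈ F` is replaceable by the edge `e ∉ F`
if `F + e` contains a cycle containing `r`. -/
def Replaceable {V : Type*} (F : Set (Sym2 V)) (r e : Sym2 V) : Prop :=
  ∃ (u : V) (W : (SimpleGraph.fromEdgeSet (insert e F)).Walk u u), W.IsCycle ∧ r ∈ W.edges

/-- Let `F` be a rainbow forest in an edge-colored graph `G` such that `G` contains no
rainbow forest with `|E(F)| + 1` edges, and let `j` be a color not used by `F`, with
`E_j` the set of edges of `G` of color `j`. Then every edge of `E_j` has both endpoints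
in the same component of `F`; the set `R ⊆ E(F)` of edges replaceable by some edge of
`E_j` is an edge cover of the vertices incident to `E_j`; and `|R| ≥ |V(E_j)|/2`. -/
theorem replaceable_edges_cover {V : Type*} [Fintype V] [DecidableEq V] {C : Type*}
    (G : SimpleGraph V) (φ : Sym2 V → C)
    (F : Finset (Sym2 V)) (hFG : F ⊆ G.edgeFinset)
    (hacyc : (SimpleGraph.fromEdgeSet (F : Set (Sym2 V))).IsAcyclic)
    (hrainbow : Set.InjOn φ ↑F)
    (hmax : ¬ ∃ T ⊆ G.edgeFinset,
      (SimpleGraph.fromEdgeSet (T : Set (Sym2 V))).IsAcyclic ∧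
      Set.InjOn φ ↑T ∧ T.card = F.card + 1)
    (j : C) (hj : j ∉ F.image φ) :
    (∀ u v : V, s(u, v) ∈ G.edgeFinset.filter (fun e => φ e = j) →
      (SimpleGraph.fromEdgeSet (F : Set (Sym2 V))).Reachable u v) ∧
    (∀ v : V, (∃ e ∈ G.edgeFinset.filter (fun e => φ e = j), v ∈ e) →
      ∃ r ∈ F.filter (fun r =>
        ∃ e ∈ G.edgeFinset.filter (fun e => φ e = j), Replaceable (↑F) r e), v ∈ r) ∧
    (Finset.univ.filter fun v : V =>
        ∃ e ∈ G.edgeFinset.filter (fun e => φ e = j), v ∈ e).card ≤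
      2 * (F.filter (fun r =>
        ∃ e ∈ G.edgeFinset.filter (fun e => φ e = j), Replaceable (↑F) r e)).card := by
  have insert_eq : ∀ u v : V, SimpleGraph.fromEdgeSet (insert s(u, v) (F : Set (Sym2 V))) =
      SimpleGraph.fromEdgeSet (F : Set (Sym2 V)) ⊔ SimpleGraph.edge u v := by
    intro u v
    rw [Set.insert_eq, Set.union_comm, SimpleGraph.fromEdgeSet_union, SimpleGraph.edge]
  have notMem : ∀ e : Sym2 V, φ e = j → e ∉ F := fun e he h =>
    hj (Finset.mem_image.2 ⟨e, h, he⟩)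
  have reach : ∀ u v : V, s(u, v) ∈ G.edgeFinset.filter (fun e => φ e = j) →
      (SimpleGraph.fromEdgeSet (F : Set (Sym2 V))).Reachable u v := by
    intro u v huv
    obtain ⟨hG, hc⟩ := Finset.mem_filter.1 huv
    by_contra hr
    refine hmax ⟨insert s(u, v) F, Finset.insert_subset hG hFG, ?_, ?_,
      Finset.card_insert_of_notMem (notMem _ hc)⟩
    · rw [Finset.coe_insert, insert_eq]
      exact (isAcyclic_add_edge_iff_of_not_reachable u v hr).2 hacyc
    · rw [Finset.coe_insert, Set.injOn_insert (by exact_mod_cast notMem _ hc)]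
      refine ⟨hrainbow, ?_⟩
      rw [hc]
      exact_mod_cast hj
  have cover : ∀ v : V, (∃ e ∈ G.edgeFinset.filter (fun e => φ e = j), v ∈ e) →
      ∃ r ∈ F.filter (fun r =>
        ∃ e ∈ G.edgeFinset.filter (fun e => φ e = j), Replaceable (↑F) r e), v ∈ r := by
    rintro v ⟨e, he, hve⟩
    obtain ⟨w, rfl⟩ := hve
    have hne : v ≠ w := (G.mem_edgeSet.1 (mem_edgeFinset.1 (Finset.mem_filter.1 he).1)).ne
    have hnF := notMem _ (Finset.mem_filter.1 he).2
    obtain ⟨p, hp⟩ := (reach v w he).exists_isPath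
    cases p with
    | nil => exact absurd rfl hne
    | @cons _ x _ h q =>
      have hle : SimpleGraph.fromEdgeSet (F : Set (Sym2 V)) ≤
          SimpleGraph.fromEdgeSet (insert s(v, w) (F : Set (Sym2 V))) :=
        SimpleGraph.fromEdgeSet_mono (Set.subset_insert _ _)
      have hadj : (SimpleGraph.fromEdgeSet (insert s(v, w) (F : Set (Sym2 V)))).Adj w v := by
        rw [SimpleGraph.fromEdgeSet_adj, Sym2.eq_swap]
        exact ⟨Set.mem_insert _ _, hne.symm⟩
      refine ⟨s(v, x), Finset.mem_filter.2 ⟨?_, s(v, w), he, w,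
        Walk.cons hadj ((Walk.cons h q).mapLe hle), ?_, ?_⟩, Sym2.mem_mk_left _ _⟩
      · exact_mod_cast (SimpleGraph.fromEdgeSet_adj _ |>.1 h).1
      · rw [Walk.cons_isCycle_iff]
        refine ⟨(Walk.isPath_mapLe hle).2 hp, fun hmem => hnF ?_⟩
        rw [Walk.edges_mapLe_eq_edges, Sym2.eq_swap] at hmem
        have := Walk.edges_subset_edgeSet _ hmem
        rw [SimpleGraph.edgeSet_fromEdgeSet] at this
        exact_mod_cast this.1
      · simp
  refine ⟨reach, cover, ?_⟩
  calc _ ≤ ((F.filter (fun r => ∃ e ∈ G.edgeFinset.filter (fun e => φ e = j),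
          Replaceable (↑F) r e)).biUnion Sym2.toFinset).card := by
        refine Finset.card_le_card fun v hv => ?_
        obtain ⟨r, hr, hvr⟩ := cover v (Finset.mem_filter.1 hv).2
        exact Finset.mem_biUnion.2 ⟨r, hr, Sym2.mem_toFinset.2 hvr⟩
    _ ≤ _ := by
        rw [mul_comm]
        refine Finset.card_biUnion_le_card_mul _ _ _ fun r _ => ?_
        rw [Sym2.card_toFinset]
        split_ifs <;> omega
end

section
/- Let G be a d-regular graph on n vertices, fix a vertex w ∈ V(G), and construct a random digraph D on V(G) by letting each vertex v ≠ w independently choose a single out-neighbor uniformly at random from its d neighbors in G (and letting w have out-degree 0). Then: (i) for each fixed cycle C of length k in G, the probability that all edges of C appear in D (ignoring orientation) is at most 2/d^k; and (ii) the expected number of cycles in D (ignoring orientation) is at most Σ_{k=3}^{n−1} n/(d·k). -/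
open Finset SimpleGraph
open scoped Classical

/-- The sample space of the random digraph `D`: functions `f : V → V` where every vertex
`v ≠ w` chooses an out-neighbor `f v` among its neighbors in `G` (and `w`, having
out-degree `0`, is normalized by `f w = w`). -/
noncomputable def outChoices {V : Type*} [Fintype V] [DecidableEq V]
    (G : SimpleGraph V) (w : V) : Finset (V → V) :=
  Finset.univ.filter fun f => f w = w ∧ ∀ v : V, v ≠ w → G.Adj v (f v)

/-- The undirected edge `e` appears in the digraph `D` determined by the choice function
`f` (and the sink `w`): some endpoint `u ≠ w` of `e` chose the other endpoint. -/
def EdgeAppears {V : Type*} (w : V) (f : V → V) (e : Sym2 V) : Prop :=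
  ∃ u v : V, e = s(u, v) ∧ u ≠ w ∧ f u = v

/-- Every step of the walk `W` goes from a vertex to its image under `f`. -/
def Follows {V : Type*} {G : SimpleGraph V} (f : V → V) {u v : V} (W : G.Walk u v) : Prop :=
  ∀ i < W.length, f (W.getVert i) = W.getVert (i + 1)

/-- The edges `s(x, f x)` met along the forward orbit of `v`. -/
noncomputable def orbitEdges {V : Type*} [Fintype V] (f : V → V) (v : V) : Finset (Sym2 V) :=
  Finset.univ.filter fun e => ∃ i : ℕ, e = s(f^[i] v, f^[i + 1] v)

lemma SimpleGraph.Walk.mem_edges_iff_getVert {V : Type*} {G : SimpleGraph V} {u v : V}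
    (W : G.Walk u v) (e : Sym2 V) :
    e ∈ W.edges ↔ ∃ i < W.length, e = s(W.getVert i, W.getVert (i + 1)) := by
  induction W with
  | nil => simp
  | cons h p ih =>
    simp only [Walk.edges_cons, List.mem_cons, ih, Walk.length_cons]
    constructor
    · rintro (rfl | ⟨i, hi, rfl⟩)
      · exact ⟨0, by omega, by simp⟩
      · exact ⟨i + 1, by omega, by simp⟩
    · rintro ⟨_ | i, hi, rfl⟩
      · left; simp
      · right; exact ⟨i, by omega, by simp⟩

/-- The walk of a cycle all of whose edges appear is followed by `f` in one of the two
directions. -/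
lemma follows_or_follows_reverse {V : Type*} {G : SimpleGraph V} {f : V → V} {w v : V}
    {W : G.Walk v v} (hW : W.IsCycle) (h : ∀ e ∈ W.edges, EdgeAppears w f e) :
    Follows f W ∨ Follows f W.reverse := by
  have h3 := hW.three_le_length
  have hstep : ∀ i < W.length, f (W.getVert i) = W.getVert (i + 1) ∨
      f (W.getVert (i + 1)) = W.getVert i := by
    intro i hi
    obtain ⟨a, b, hab, -, hf⟩ := h _ ((W.mem_edges_iff_getVert _).2 ⟨i, hi, rfl⟩)
    rcases Sym2.eq_iff.1 hab with ⟨h1, h2⟩ | ⟨h1, h2⟩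
    · left; rw [h1, h2, hf]
    · right; rw [h1, h2, hf]
  by_cases hall : Follows f W
  · exact Or.inl hall
  right
  unfold Follows at hall
  push Not at hall
  obtain ⟨i₀, hi₀, hne⟩ := hall
  have hb₀ := (hstep i₀ hi₀).resolve_left hne
  have hsucc : ∀ i, i + 1 < W.length → f (W.getVert (i + 1)) = W.getVert i →
      f (W.getVert (i + 2)) = W.getVert (i + 1) := by
    intro i hi hb
    refine (hstep (i + 1) hi).resolve_left fun hf => ?_
    exact hW.getVert_sub_one_ne_getVert_add_one (i := i + 1) hi.le (hb.symm.trans hf)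
  have hup : ∀ i, f (W.getVert (i + 1)) = W.getVert i → ∀ j, i ≤ j → j < W.length →
      f (W.getVert (j + 1)) = W.getVert j := by
    intro i hb j hij
    induction j, hij using Nat.le_induction with
    | base => exact fun _ => hb
    | succ j _ ih => exact fun hj => hsucc j hj (ih (by omega))
  have hlast := hup i₀ hb₀ (W.length - 1) (by omega) (by omega)
  rw [show W.length - 1 + 1 = W.length by omega, W.getVert_length] at hlast
  have hzero : f (W.getVert (0 + 1)) = W.getVert 0 := by
    refine (hstep 0 (by omega)).resolve_left fun hf => ?_
    rw [W.getVert_zero, hlast] at hf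
    have := hW.getVert_injOn (by simp only [Set.mem_ofPred_eq]; omega)
      (by simp only [Set.mem_ofPred_eq]; omega) hf
    omega
  intro i hi
  rw [Walk.length_reverse] at hi
  have := hup 0 hzero (W.length - (i + 1)) (by omega) (by omega)
  rwa [Walk.getVert_reverse, Walk.getVert_reverse,
    show W.length - i = W.length - (i + 1) + 1 by omega]

lemma Follows.getVert_ne {V : Type*} {G : SimpleGraph V} {f : V → V} {w u v : V}
    {W : G.Walk u v} (h : Follows f W) (hw : f w = w) {i : ℕ} (hi : i < W.length) :
    W.getVert i ≠ w := by
  intro hiw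
  have hadj := W.adj_getVert_succ hi
  rw [← h i hi, hiw, hw] at hadj
  exact hadj.ne rfl

lemma Follows.getVert_eq_iterate {V : Type*} {G : SimpleGraph V} {f : V → V} {u v : V}
    {W : G.Walk u v} (h : Follows f W) {i : ℕ} (hi : i ≤ W.length) :
    W.getVert i = f^[i] u := by
  induction i with
  | zero => simp
  | succ i ih => rw [← h i (by omega), ih (by omega), Function.iterate_succ_apply']

lemma Follows.isPeriodicPt {V : Type*} {G : SimpleGraph V} {f : V → V} {v : V}
    {W : G.Walk v v} (h : Follows f W) : Function.IsPeriodicPt f W.length v := by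
  have := h.getVert_eq_iterate le_rfl
  rw [W.getVert_length] at this
  exact this.symm

lemma Follows.minimalPeriod_eq {V : Type*} {G : SimpleGraph V} {f : V → V} {v : V}
    {W : G.Walk v v} (h : Follows f W) (hW : W.IsCycle) :
    Function.minimalPeriod f v = W.length := by
  have h3 := hW.three_le_length
  have hpos := h.isPeriodicPt.minimalPeriod_pos (by omega)
  have hle := h.isPeriodicPt.minimalPeriod_le (by omega)
  have h1 := h.getVert_eq_iterate hle
  rw [Function.iterate_minimalPeriod, hW.getVert_endpoint_iff hle] at h1
  omega

lemma Follows.orbitEdges_iterate {V : Type*} [Fintype V] [DecidableEq V] {G : SimpleGraph V}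
    {f : V → V} {v : V} {W : G.Walk v v} (h : Follows f W) {j : ℕ} (hj : j < W.length) :
    orbitEdges f (f^[j] v) = W.edges.toFinset := by
  have hper := h.isPeriodicPt
  ext e
  simp only [orbitEdges, Finset.mem_filter, Finset.mem_univ, true_and, List.mem_toFinset,
    W.mem_edges_iff_getVert, ← Function.iterate_add_apply]
  constructor
  · rintro ⟨i, rfl⟩
    have hlt : (i + j) % W.length < W.length := Nat.mod_lt _ (by omega)
    refine ⟨(i + j) % W.length, hlt, ?_⟩
    rw [h.getVert_eq_iterate hlt.le, h.getVert_eq_iterate hlt, Function.iterate_succ_apply',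
      hper.iterate_mod_apply, ← Function.iterate_succ_apply' f, show i + 1 + j = (i + j) + 1 by ring]
  · rintro ⟨i, hi, rfl⟩
    refine ⟨i + (W.length - j), ?_⟩
    rw [h.getVert_eq_iterate hi.le, h.getVert_eq_iterate hi,
      show i + (W.length - j) + 1 + j = i + 1 + W.length by omega,
      show i + (W.length - j) + j = i + W.length by omega,
      Function.iterate_add_apply f (i + 1), Function.iterate_add_apply f i, hper]

lemma outChoices_eq_piFinset {V : Type*} [Fintype V] [DecidableEq V] (G : SimpleGraph V) (w : V) :
    outChoices G w = Fintype.piFinset fun v => if v = w then {w} else G.neighborFinset v := by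
  ext f
  simp only [outChoices, Finset.mem_filter, Finset.mem_univ, true_and, Fintype.mem_piFinset]
  constructor
  · rintro ⟨hw, hf⟩ v
    split_ifs with hv
    · simp [hv, hw]
    · simpa using hf v hv
  · intro hf
    refine ⟨by simpa using hf w, fun v hv => ?_⟩
    simpa [hv] using hf v

lemma card_outChoices {V : Type*} [Fintype V] [DecidableEq V] (G : SimpleGraph V) {d : ℕ}
    (hreg : G.IsRegularOfDegree d) (w : V) :
    (outChoices G w).card = d ^ (Fintype.card V - 1) := by
  rw [outChoices_eq_piFinset, Fintype.card_piFinset, ← Finset.mul_prod_erase _ _ (mem_univ w)]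
  rw [Finset.prod_congr rfl (g := fun _ => d)]
  · simp
  · intro v hv
    rw [if_neg (Finset.ne_of_mem_erase hv)]
    exact hreg v

lemma card_follows_mul_pow_le {V : Type*} [Fintype V] [DecidableEq V] (G : SimpleGraph V) {d : ℕ}
    (hreg : G.IsRegularOfDegree d) (w v : V) {W : G.Walk v v} (hW : W.IsCycle) :
    ((outChoices G w).filter fun f => Follows f W).card * d ^ W.length ≤
      d ^ (Fintype.card V - 1) := by
  rcases ((outChoices G w).filter fun f => Follows f W).eq_empty_or_nonempty with he | ⟨f₀, hf₀⟩
  · simp [he]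
  obtain ⟨hf₀, hfol⟩ := Finset.mem_filter.1 hf₀
  have hw₀ : f₀ w = w := (Finset.mem_filter.1 hf₀).2.1
  set S : Finset V := (Finset.range W.length).image W.getVert with hS
  have hScard : S.card = W.length := by
    rw [hS, Finset.card_image_of_injOn, Finset.card_range]
    intro i hi j hj hij
    simp only [Finset.coe_range, Set.mem_Iio] at hi hj
    exact hW.getVert_injOn' (by simp only [Set.mem_ofPred_eq]; omega)
      (by simp only [Set.mem_ofPred_eq]; omega) hij
  have hwS : w ∉ S := by
    simp only [hS, Finset.mem_image, Finset.mem_range, not_exists, not_and]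
    exact fun i hi => hfol.getVert_ne hw₀ hi
  have hsub : ((outChoices G w).filter fun f => Follows f W) ⊆
      Fintype.piFinset fun v =>
        if v = w then {w} else if v ∈ S then {f₀ v} else G.neighborFinset v := by
    intro f hf
    obtain ⟨hf, hff⟩ := Finset.mem_filter.1 hf
    rw [outChoices_eq_piFinset, Fintype.mem_piFinset] at hf
    rw [Fintype.mem_piFinset]
    intro v
    have hv := hf v
    split_ifs at hv ⊢ with h1 h2
    · exact hv
    · obtain ⟨i, hi, rfl⟩ := Finset.mem_image.1 h2
      rw [Finset.mem_range] at hi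
      rw [Finset.mem_singleton, hff i hi, hfol i hi]
    · exact hv
  have hSsub : S ⊆ Finset.univ.erase w := fun x hx =>
    Finset.mem_erase.2 ⟨fun h => hwS (h ▸ hx), Finset.mem_univ x⟩
  have hcard : (Fintype.piFinset fun v =>
      if v = w then {w} else if v ∈ S then {f₀ v} else G.neighborFinset v).card =
      d ^ (Fintype.card V - 1 - W.length) := by
    rw [Fintype.card_piFinset, ← Finset.mul_prod_erase _ _ (mem_univ w),
      ← Finset.prod_sdiff hSsub, Finset.prod_congr rfl (g := fun _ => d),
      Finset.prod_congr (s₁ := S) rfl (g := fun _ => 1)]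
    · simp [Finset.card_sdiff_of_subset hSsub, hScard]
    · intro v hv
      have hvw : v ≠ w := fun h => hwS (h ▸ hv)
      rw [if_neg hvw, if_pos hv, Finset.card_singleton]
    · intro v hv
      obtain ⟨h1, h2⟩ := Finset.mem_sdiff.1 hv
      rw [if_neg (Finset.ne_of_mem_erase h1), if_neg h2]
      exact hreg v
  have hle : W.length ≤ Fintype.card V - 1 := by
    have := Finset.card_le_card hSsub
    rwa [hScard, Finset.card_erase_of_mem (mem_univ w), Finset.card_univ] at this
  calc _ ≤ d ^ (Fintype.card V - 1 - W.length) * d ^ W.length := by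
        rw [← hcard]
        exact Nat.mul_le_mul_right _ (Finset.card_le_card hsub)
    _ = _ := by rw [← pow_add, Nat.sub_add_cancel hle]

lemma iterate_ne_of_minimalPeriod {V : Type*} {f : V → V} {w v : V} (hw : f w = w)
    (h : 2 ≤ Function.minimalPeriod f v) (i : ℕ) : f^[i] v ≠ w := by
  intro hi
  have hp : v ∈ Function.periodicPts f :=
    Function.minimalPeriod_pos_iff_mem_periodicPts.1 (by omega)
  have h1 := Function.minimalPeriod_apply_iterate hp i
  rw [hi, Function.minimalPeriod_eq_one_iff_isFixedPt.2 hw] at h1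
  omega

lemma minimalPeriod_lt_card {V : Type*} [Fintype V] {f : V → V} {w v : V} (hw : f w = w)
    (h : 2 ≤ Function.minimalPeriod f v) :
    Function.minimalPeriod f v + 1 ≤ Fintype.card V := by
  have hcard : ((Finset.range (Function.minimalPeriod f v)).image fun i => f^[i] v).card =
      Function.minimalPeriod f v := by
    rw [Finset.card_image_of_injOn, Finset.card_range]
    rw [Finset.coe_range]
    exact Function.iterate_injOn_Iio_minimalPeriod
  have hw' : w ∉ (Finset.range (Function.minimalPeriod f v)).image fun i => f^[i] v := by
    simp only [Finset.mem_image, not_exists, not_and]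
    exact fun i _ => iterate_ne_of_minimalPeriod hw h i
  rw [← hcard, ← Finset.card_insert_of_notMem hw']
  exact Finset.card_le_univ _

lemma iterate_update_of_lt_minimalPeriod {V : Type*} [DecidableEq V] {f : V → V} {v : V} {k : ℕ}
    (hk : Function.minimalPeriod f v = k + 1) (x : V) {i : ℕ} (hi : i ≤ k) :
    (Function.update f (f^[k] v) x)^[i] v = f^[i] v := by
  induction i with
  | zero => rfl
  | succ i ih =>
    rw [Function.iterate_succ_apply', ih (by omega), Function.update_of_ne,
      Function.iterate_succ_apply']
    intro h
    have := Function.iterate_injOn_Iio_minimalPeriod (f := f) (x := v)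
      (show i ∈ Set.Iio _ by simp only [Set.mem_Iio]; omega)
      (show k ∈ Set.Iio _ by simp only [Set.mem_Iio]; omega) h
    omega

/-- Redirecting the predecessor of `v` on its cycle to an arbitrary neighbor is injective, so `v`
lies on a cycle of a prescribed length with probability at most `1 / d`. -/
lemma card_minimalPeriod_mul_le {V : Type*} [Fintype V] [DecidableEq V] (G : SimpleGraph V)
    {d : ℕ} (hreg : G.IsRegularOfDegree d) (w v : V) {k : ℕ} (hk : 1 ≤ k) :
    ((outChoices G w).filter fun f => Function.minimalPeriod f v = k + 1).card * d ≤
      d ^ (Fintype.card V - 1) := by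
  rw [← card_outChoices G hreg w]
  have hsig : (((outChoices G w).filter fun f => Function.minimalPeriod f v = k + 1).sigma
      fun f => G.neighborFinset (f^[k] v)).card =
      ((outChoices G w).filter fun f => Function.minimalPeriod f v = k + 1).card * d := by
    rw [Finset.card_sigma, Finset.sum_const_nat]
    exact fun f _ => hreg _
  rw [← hsig]
  refine Finset.card_le_card_of_injOn (fun p => Function.update p.1 (p.1^[k] v) p.2) ?_ ?_
  · rintro ⟨f, x⟩ hp
    simp only [Finset.coe_sigma, Set.mem_sigma_iff, Finset.mem_coe, Finset.mem_filter,
      mem_neighborFinset] at hp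
    obtain ⟨⟨hf, hper⟩, hx⟩ := hp
    simp only [outChoices, Finset.mem_filter, Finset.mem_univ, true_and, Finset.mem_coe] at hf ⊢
    refine ⟨?_, fun u hu => ?_⟩
    · rw [Function.update_of_ne (iterate_ne_of_minimalPeriod hf.1 (by omega) k).symm, hf.1]
    · by_cases hu' : u = f^[k] v
      · subst hu'
        simpa using hx
      · rw [Function.update_of_ne hu']
        exact hf.2 u hu
  · rintro ⟨f, x⟩ hp ⟨g, y⟩ hq h
    simp only [Finset.coe_sigma, Set.mem_sigma_iff, Finset.mem_coe, Finset.mem_filter] at hp hq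
    have hp := hp.1.2
    have hq := hq.1.2
    simp only at h
    have hlast : f^[k] v = g^[k] v := by
      rw [← iterate_update_of_lt_minimalPeriod hp x le_rfl, h,
        iterate_update_of_lt_minimalPeriod hq y le_rfl]
    have hfv : f (f^[k] v) = v := by
      rw [← Function.iterate_succ_apply' f]
      exact (congrArg (fun m => f^[m] v) hp.symm).trans Function.iterate_minimalPeriod
    have hgv : g (g^[k] v) = v := by
      rw [← Function.iterate_succ_apply' g]
      exact (congrArg (fun m => g^[m] v) hq.symm).trans Function.iterate_minimalPeriod
    have hxy : x = y := by
      have := congrFun h (f^[k] v)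
      rwa [Function.update_self, hlast, Function.update_self] at this
    have hfg : f = g := by
      funext u
      by_cases hu : u = f^[k] v
      · rw [hu, hfv, hlast, hgv]
      · have := congrFun h u
        rwa [Function.update_of_ne hu, Function.update_of_ne (hlast ▸ hu)] at this
    subst hxy hfg
    rfl

/-- Each cycle appearing in `f` is the orbit of as many periodic points as its length. -/
lemma ncard_cycles_le {V : Type*} [Fintype V] [DecidableEq V] (G : SimpleGraph V) {w : V}
    {f : V → V} (hf : f w = w) :
    (({C : Finset (Sym2 V) | ∃ (v : V) (W : G.Walk v v),
      W.IsCycle ∧ W.edges.toFinset = C ∧ ∀ e ∈ C, EdgeAppears w f e}.ncard : ℝ)) ≤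
    ∑ k ∈ Finset.Icc 3 (Fintype.card V - 1), ∑ v : V,
      if Function.minimalPeriod f v = k then (1 : ℝ) / k else 0 := by
  set A := {C : Finset (Sym2 V) | ∃ (v : V) (W : G.Walk v v),
      W.IsCycle ∧ W.edges.toFinset = C ∧ ∀ e ∈ C, EdgeAppears w f e} with hA
  set Q : Finset V := Finset.univ.filter fun v => 3 ≤ Function.minimalPeriod f v with hQ
  have hweight : ∑ v ∈ Q, (1 : ℝ) / Function.minimalPeriod f v =
      ∑ k ∈ Finset.Icc 3 (Fintype.card V - 1), ∑ v : V,
        if Function.minimalPeriod f v = k then (1 : ℝ) / k else 0 := by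
    rw [Finset.sum_comm, hQ, Finset.sum_filter]
    refine Finset.sum_congr rfl fun v _ => ?_
    rw [Finset.sum_ite_eq]
    refine if_congr ?_ rfl rfl
    rw [Finset.mem_Icc]
    refine ⟨fun h => ⟨h, ?_⟩, fun h => h.1⟩
    have := minimalPeriod_lt_card hf (v := v) (by omega)
    omega
  have hfiber : ∀ C ∈ A.toFinset,
      (1 : ℝ) ≤ ∑ v ∈ Q with orbitEdges f v = C, (1 : ℝ) / Function.minimalPeriod f v := by
    intro C hC
    obtain ⟨v, W, hW, hWC, happ⟩ := Set.mem_toFinset.1 hC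
    have hdir : ∃ W' : G.Walk v v, W'.IsCycle ∧ W'.edges.toFinset = C ∧ Follows f W' := by
      rcases follows_or_follows_reverse hW
        (fun e he => happ e (hWC ▸ List.mem_toFinset.2 he)) with h | h
      · exact ⟨W, hW, hWC, h⟩
      · refine ⟨W.reverse, hW.reverse, ?_, h⟩
        rw [Walk.edges_reverse, List.toFinset_reverse, hWC]
    obtain ⟨W', hW', rfl, hfol⟩ := hdir
    have h3 := hW'.three_le_length
    have hmp := hfol.minimalPeriod_eq hW'
    have hpp : v ∈ Function.periodicPts f :=
      Function.minimalPeriod_pos_iff_mem_periodicPts.1 (by omega)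
    set S : Finset V := (Finset.range W'.length).image fun i => f^[i] v with hS
    have hmpS : ∀ u ∈ S, Function.minimalPeriod f u = W'.length := by
      intro u hu
      obtain ⟨i, -, rfl⟩ := Finset.mem_image.1 hu
      rw [Function.minimalPeriod_apply_iterate hpp, hmp]
    have hScard : S.card = W'.length := by
      rw [hS, Finset.card_image_of_injOn, Finset.card_range]
      rw [Finset.coe_range, ← hmp]
      exact Function.iterate_injOn_Iio_minimalPeriod
    have hSsub : S ⊆ Q.filter fun u => orbitEdges f u = W'.edges.toFinset := by
      intro u hu
      refine Finset.mem_filter.2 ⟨Finset.mem_filter.2 ⟨Finset.mem_univ _, ?_⟩, ?_⟩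
      · rw [hmpS u hu]; exact h3
      · obtain ⟨i, hi, rfl⟩ := Finset.mem_image.1 hu
        exact hfol.orbitEdges_iterate (Finset.mem_range.1 hi)
    calc (1 : ℝ) = ∑ u ∈ S, (1 : ℝ) / W'.length := by
          rw [Finset.sum_const, hScard, nsmul_eq_mul, mul_one_div_cancel]
          exact_mod_cast (by omega : W'.length ≠ 0)
      _ = ∑ u ∈ S, (1 : ℝ) / Function.minimalPeriod f u :=
          Finset.sum_congr rfl fun u hu => by rw [hmpS u hu]
      _ ≤ _ := Finset.sum_le_sum_of_subset_of_nonneg hSsub fun _ _ _ => by positivity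
  rw [← hweight, Set.ncard_eq_toFinset_card', Finset.cast_card]
  calc ∑ _C ∈ A.toFinset, (1 : ℝ) ≤
        ∑ C ∈ A.toFinset, ∑ v ∈ Q with orbitEdges f v = C,
          (1 : ℝ) / Function.minimalPeriod f v := Finset.sum_le_sum hfiber
    _ ≤ _ := Finset.sum_fiberwise_le_sum_of_sum_fiber_nonneg
        fun _ _ => Finset.sum_nonneg fun _ _ => by positivity

/-- Let `G` be `d`-regular on `n` vertices, fix `w`, and let each `v ≠ w` pick a uniformly
random out-neighbor (forming the random digraph `D`). Then (i) each fixed cycle of length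
`k` in `G` appears in `D` (ignoring orientation) with probability at most `2/d^k`, and
(ii) the expected number of cycles in `D` (ignoring orientation) is at most
`Σ_{k=3}^{n−1} n/(d·k)`. -/
theorem random_functional_digraph_cycles {V : Type*} [Fintype V] [DecidableEq V]
    (G : SimpleGraph V) (n d : ℕ) (hn : Fintype.card V = n)
    (hreg : G.IsRegularOfDegree d) (w : V) :
    (∀ (k : ℕ) (v₀ : V) (W : G.Walk v₀ v₀), W.IsCycle → W.length = k →
      (((outChoices G w).filter fun f => ∀ e ∈ W.edges, EdgeAppears w f e).card : ℝ) /
          (d : ℝ) ^ (n - 1) ≤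
        2 / (d : ℝ) ^ k) ∧
    (∑ f ∈ outChoices G w,
        (({C : Finset (Sym2 V) | ∃ (v : V) (W : G.Walk v v),
          W.IsCycle ∧ W.edges.toFinset = C ∧ ∀ e ∈ C, EdgeAppears w f e}.ncard : ℝ))) /
        (d : ℝ) ^ (n - 1) ≤
      ∑ k ∈ Finset.Icc 3 (n - 1), (n : ℝ) / (d * k) := by
  subst hn
  refine ⟨?_, ?_⟩
  · rintro k v₀ W hW rfl
    have h3 := hW.three_le_length
    have hd : 0 < d := by
      rw [← hreg v₀]
      exact G.degree_pos_iff_exists_adj v₀ |>.2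
        ⟨_, by simpa using W.adj_getVert_succ (i := 0) (by omega)⟩
    have hsub : ((outChoices G w).filter fun f => ∀ e ∈ W.edges, EdgeAppears w f e) ⊆
        ((outChoices G w).filter fun f => Follows f W) ∪
          ((outChoices G w).filter fun f => Follows f W.reverse) := by
      intro f hf
      rw [← Finset.filter_or]
      obtain ⟨hf, happ⟩ := Finset.mem_filter.1 hf
      exact Finset.mem_filter.2 ⟨hf, follows_or_follows_reverse hW happ⟩
    have h1 := card_follows_mul_pow_le G hreg w v₀ hW
    have h2 := card_follows_mul_pow_le G hreg w v₀ hW.reverse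
    rw [Walk.length_reverse] at h2
    have hcard := (Finset.card_le_card hsub).trans (Finset.card_union_le _ _)
    rw [div_le_div_iff₀ (by positivity) (by positivity)]
    have := Nat.mul_le_mul_right (d ^ W.length) hcard
    rw [add_mul] at this
    exact_mod_cast (by omega :
      ((outChoices G w).filter fun f => ∀ e ∈ W.edges, EdgeAppears w f e).card * d ^ W.length ≤
        2 * d ^ (Fintype.card V - 1))
  · have hsum : ∑ f ∈ outChoices G w, (({C : Finset (Sym2 V) | ∃ (v : V) (W : G.Walk v v),
          W.IsCycle ∧ W.edges.toFinset = C ∧ ∀ e ∈ C, EdgeAppears w f e}.ncard : ℝ)) ≤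
        ∑ k ∈ Finset.Icc 3 (Fintype.card V - 1), ∑ v : V,
          (((outChoices G w).filter fun f => Function.minimalPeriod f v = k).card : ℝ) / k := by
      refine (Finset.sum_le_sum fun f hf =>
        ncard_cycles_le G (Finset.mem_filter.1 hf).2.1).trans_eq ?_
      rw [Finset.sum_comm]
      refine Finset.sum_congr rfl fun k _ => ?_
      rw [Finset.sum_comm]
      refine Finset.sum_congr rfl fun v _ => ?_
      rw [← Finset.sum_filter, Finset.sum_const, nsmul_eq_mul, mul_one_div]
    refine (div_le_div_of_nonneg_right hsum (by positivity)).trans ?_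
    rw [Finset.sum_div]
    refine Finset.sum_le_sum fun k hk => ?_
    rw [Finset.mem_Icc] at hk
    rcases Nat.eq_zero_or_pos d with rfl | hd
    · rw [Nat.cast_zero, zero_pow (by omega), div_zero, zero_mul, div_zero]
    have hkpos : 0 < k := by omega
    rw [div_le_div_iff₀ (by positivity) (by positivity), Finset.sum_mul]
    have hk0 : (k : ℝ) ≠ 0 := by exact_mod_cast (by omega : k ≠ 0)
    have hbound : ∀ v : V, (((outChoices G w).filter
        fun f => Function.minimalPeriod f v = k).card : ℝ) / k * (d * k) ≤
        (d : ℝ) ^ (Fintype.card V - 1) := by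
      intro v
      have h := card_minimalPeriod_mul_le G hreg w v (k := k - 1) (by omega)
      rw [show k - 1 + 1 = k by omega] at h
      rw [show ∀ a : ℝ, a / k * (d * k) = a * d by intro a; field_simp]
      exact_mod_cast h
    exact (Finset.sum_le_sum fun v _ => hbound v).trans_eq (by simp)
end
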